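/- arXiv:1903.12315 — 2 statements merged into one kernel-verified Lean document; each statement's English description precedes it below -/
import Mathlib

section
/- Let α ∈ (0,1], δ ∈ (-1,1) (with δ = 0 if α = 1), Z ~ S_α(δ) with density p, and let h ∈ H_β with 0 < β < α. Define f(x) := −∫_0^∞ ∫_ℝ p(y) [h((1 − e^{−t})^{1/α} y + e^{−t/α} x) − h(y)] dy dt. Then f is well-defined, differentiable, and solves Stein's equation: for all x ∈ ℝ, L^{α,δ} f(x) − (1/α) x f'(x) = h(x) − E[h(Z)]. -/
open MeasureTheory Real Filter Set
open scoped Topology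

noncomputable section

/-- Normalizing constant `d_α`. -/
def dconst (α : ℝ) : ℝ :=
  if α = 1 then 2 / π else -1 / (Real.Gamma (-α) * Real.cos (π * α / 2))

/-- Density of the Lévy measure `ν_{α,δ}` with respect to Lebesgue measure. -/
def nuDens (α δ : ℝ) (u : ℝ) : ℝ :=
  dconst α * (if 0 < u then (1 + δ) / 2 * u ^ (-1 - α)
    else if u < 0 then (1 - δ) / 2 * |u| ^ (-1 - α) else 0)

/-- Generator `L^{α,δ}` for `α ∈ (0,1)`. -/
def Lop (α δ : ℝ) (f : ℝ → ℝ) (x : ℝ) : ℝ :=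
  ∫ u, (f (x + u) - f x) * nuDens α δ u

/-- Generator `L^{1,0}` (note `ν_{1,0}(du) = (2/π)|u|⁻²/2 du = 1/(π u²) du`). -/
def Lop1 (f : ℝ → ℝ) (x : ℝ) : ℝ :=
  ∫ u, (f (x + u) - f x - (if |u| ≤ 1 then u * deriv f x else 0)) * (1 / (π * u ^ 2))

/-- Combined generator. -/
def LopA (α δ : ℝ) (f : ℝ → ℝ) (x : ℝ) : ℝ :=
  if α = 1 then Lop1 f x else Lop α δ f x

/-- Characteristic function of the strictly `α`-stable law at time `t`. -/
def stableCF (α δ t l : ℝ) : ℂ :=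
  if α = 1 then Complex.exp (↑(-(t * |l|)) : ℂ)
  else Complex.exp ((↑(-(t * |l| ^ α)) : ℂ) *
    (1 - Complex.I * (δ : ℂ) * ((Real.sign l : ℝ) : ℂ) * ((Real.tan (π * α / 2) : ℝ) : ℂ)))

/-- `μ` is the strictly `α`-stable law `S_α(δ)`. -/
def IsStableLaw (α δ : ℝ) (μ : Measure ℝ) : Prop :=
  ∀ l : ℝ, (∫ x, Complex.exp (Complex.I * (l : ℂ) * (x : ℂ)) ∂μ) = stableCF α δ 1 l

/-- The class `H_β`. -/
def memHbeta (β : ℝ) (h : ℝ → ℝ) : Prop :=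
  ∀ x y : ℝ, |h x - h y| ≤ min |x - y| (|x - y| ^ β)

/-- The distance `d_{W_β}`. -/
def dWbeta (β : ℝ) (μ ν : Measure ℝ) : ℝ :=
  sSup { r | ∃ h : ℝ → ℝ, memHbeta β h ∧ r = |(∫ x, h x ∂μ) - ∫ x, h x ∂ν| }

/-- The Kolmogorov distance. -/
def dKol (μ ν : Measure ℝ) : ℝ :=
  sSup { r | ∃ x : ℝ, r = |(μ (Set.Iic x)).toReal - (ν (Set.Iic x)).toReal| }

/-- The solution of Stein's equation. -/
def steinSol (α : ℝ) (p h : ℝ → ℝ) (x : ℝ) : ℝ :=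
  -∫ t in Set.Ioi (0:ℝ), ∫ y, p y *
    (h ((1 - Real.exp (-t)) ^ (1/α) * y + Real.exp (-t/α) * x) - h y)


lemma norm_exp_neg_sub_one_le {z : ℂ} (hz : 0 ≤ z.re) : ‖Complex.exp (-z) - 1‖ ≤ ‖z‖ := by
  have hconv : Convex ℝ {w : ℂ | w.re ≤ 0} := convex_halfSpace_re_le 0
  have := hconv.norm_image_sub_le_of_norm_hasDerivWithin_le (f := Complex.exp) (f' := Complex.exp)
    (C := 1) (x := 0) (y := -z)
    (fun x _ => (Complex.hasDerivAt_exp x).hasDerivWithinAt)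
    (fun x hx => by rw [Complex.norm_exp]; exact Real.exp_le_one_iff.mpr hx)
    (by simp) (by simpa using hz)
  simpa using this


lemma integrableOn_min_rpow {a b s : ℝ} (hb : b < s) (ha : s < a) :
    IntegrableOn (fun u : ℝ => min (u ^ a) (u ^ b) * u ^ (-1 - s)) (Ioi 0) := by
  have hmeas : Measurable (fun u : ℝ => min (u ^ a) (u ^ b) * u ^ (-1 - s)) := by fun_prop
  rw [← Ioc_union_Ioi_eq_Ioi (zero_le_one (α := ℝ))]
  refine IntegrableOn.union ?_ ?_
  · have h1 : IntegrableOn (fun u : ℝ => u ^ (a - 1 - s)) (Ioc 0 1) := by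
      have := intervalIntegral.intervalIntegrable_rpow' (a := 0) (b := 1) (r := a - 1 - s) (by linarith)
      rwa [intervalIntegrable_iff_integrableOn_Ioc_of_le zero_le_one] at this
    refine Integrable.mono' h1 hmeas.aestronglyMeasurable ?_
    filter_upwards [ae_restrict_mem measurableSet_Ioc] with u hu
    have hu0 := hu.1
    rw [Real.norm_of_nonneg (by positivity), show a - 1 - s = a + (-1 - s) by ring,
      Real.rpow_add hu0]
    gcongr
    exact min_le_left _ _
  · have h1 : IntegrableOn (fun u : ℝ => u ^ (b - 1 - s)) (Ioi 1) :=
      integrableOn_Ioi_rpow_of_lt (by linarith) one_pos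
    refine Integrable.mono' h1 hmeas.aestronglyMeasurable ?_
    filter_upwards [ae_restrict_mem measurableSet_Ioi] with u hu
    have hu0 : 0 < u := lt_trans one_pos hu
    rw [Real.norm_of_nonneg (by positivity), show b - 1 - s = b + (-1 - s) by ring,
      Real.rpow_add hu0]
    gcongr
    exact min_le_right _ _

lemma integrable_of_halves {E : Type*} [NormedAddCommGroup E] [NormedSpace ℝ E] {f : ℝ → E}
    (h1 : IntegrableOn f (Ioi 0)) (h2 : IntegrableOn (fun u => f (-u)) (Ioi 0)) :
    Integrable f ∧ ∫ u, f u = (∫ u in Ioi 0, f u) + ∫ u in Ioi 0, f (-u) := by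
  have h3 : IntegrableOn f (Iic 0) := by
    have h4 : IntegrableOn (fun u => f (-u)) (Ioi (-0)) := by simpa using h2
    have := h4.comp_neg_Iio
    rw [← integrableOn_Iic_iff_integrableOn_Iio] at this
    simpa using this
  have h5 : Integrable f := by
    rw [← integrableOn_univ, ← Iic_union_Ioi (a := (0:ℝ))]
    exact h3.union h1
  refine ⟨h5, ?_⟩
  have := integral_comp_neg_Ioi 0 f
  rw [this, neg_zero, add_comm]
  exact (intervalIntegral.integral_Iic_add_Ioi h3 h1).symm

lemma integrable_min_rpow_abs {a b s : ℝ} (hb : b < s) (ha : s < a) :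
    Integrable (fun u : ℝ => min (|u| ^ a) (|u| ^ b) * |u| ^ (-1 - s)) := by
  have h := integrableOn_min_rpow hb ha
  have h' : IntegrableOn (fun u : ℝ => min (|u| ^ a) (|u| ^ b) * |u| ^ (-1 - s)) (Ioi 0) :=
    h.congr_fun (fun u hu => by simp only [abs_of_pos (mem_Ioi.mp hu)]) measurableSet_Ioi
  exact (integrable_of_halves h' (by simpa only [abs_neg] using h')).1

lemma moment_of_charFun (μ : Measure ℝ) [IsProbabilityMeasure μ] {α β C : ℝ} (hβ : 0 < β)
    (hβα : β < α) (hC : ∀ l : ℝ, ‖1 - charFun μ l‖ ≤ C * |l| ^ α) :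
    Integrable (fun x : ℝ => |x| ^ β) μ := by
  have hα : 0 < α := hβ.trans hβα
  have hC0 : 0 ≤ C := by simpa using (norm_nonneg _).trans (hC 1)
  set D : ℝ := max 1 (2 * C * 2 ^ α) with hD
  have htail : ∀ r : ℝ, 0 < r → μ.real {x | r < |x|} ≤ D * min 1 (r ^ (-α)) := by
    intro r hr
    rw [mul_min_of_nonneg _ _ (by positivity)]
    refine le_min ?_ ?_
    · rw [mul_one]; exact measureReal_le_one.trans (le_max_left _ _)
    · refine (measureReal_abs_gt_le_integral_charFun hr).trans ?_
      have : ‖∫ (t : ℝ) in -2 * r⁻¹..2 * r⁻¹, 1 - charFun μ t‖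
          ≤ (C * (2 * r⁻¹) ^ α) * |2 * r⁻¹ - (-2 * r⁻¹)| := by
        refine intervalIntegral.norm_integral_le_of_norm_le_const ?_
        intro x hx
        refine (hC x).trans ?_
        have hri : 0 < r⁻¹ := inv_pos.mpr hr
        rw [uIoc_of_le (by linarith)] at hx
        gcongr
        rw [abs_le]; constructor <;> linarith [hx.1, hx.2]
      have hri : 0 < r⁻¹ := inv_pos.mpr hr
      calc 2⁻¹ * r * ‖∫ (t : ℝ) in -2 * r⁻¹..2 * r⁻¹, 1 - charFun μ t‖
          ≤ 2⁻¹ * r * ((C * (2 * r⁻¹) ^ α) * |2 * r⁻¹ - (-2 * r⁻¹)|) := by gcongr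
        _ = 2 * C * 2 ^ α * r ^ (-α) := by
          rw [abs_of_pos (by linarith), Real.mul_rpow (by norm_num) hri.le,
            Real.inv_rpow hr.le, Real.rpow_neg hr.le]
          field_simp; ring
        _ ≤ D * r ^ (-α) := by gcongr; exact le_max_right _ _
  have hInteg : IntegrableOn (fun t : ℝ => D * (min (t ^ (0:ℝ)) (t ^ (-α)) * t ^ (-1 - (-β)))) (Ioi 0) :=
    (integrableOn_min_rpow (by linarith) (by linarith)).const_mul D
  refine ⟨(by fun_prop : Measurable fun x : ℝ => |x| ^ β).aestronglyMeasurable, ?_⟩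
  rw [hasFiniteIntegral_iff_ofReal (Eventually.of_forall fun x => by positivity),
    lintegral_rpow_eq_lintegral_meas_lt_mul μ (Eventually.of_forall fun x => abs_nonneg x)
      (by fun_prop) hβ]
  refine ENNReal.mul_lt_top ENNReal.ofReal_lt_top ?_
  refine lt_of_le_of_lt ?_ hInteg.lintegral_lt_top
  refine setLIntegral_mono' measurableSet_Ioi fun t ht => ?_
  have ht0 : 0 < t := ht
  have h2 := htail t ht
  rw [← ENNReal.ofReal_toReal (measure_ne_top μ {a | t < |a|}),
    ← ENNReal.ofReal_mul ENNReal.toReal_nonneg]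
  refine ENNReal.ofReal_le_ofReal ?_
  rw [← mul_assoc, Real.rpow_zero, show -1 - -β = β - 1 by ring]
  gcongr
  exact h2


/-- the integrand of the Lévy symbol on the half line -/
def symbI (α : ℝ) (z : ℂ) (u : ℝ) : ℂ := (Complex.exp (-(z * u)) - 1) * ((u ^ (-1 - α) : ℝ) : ℂ)

lemma norm_symbI_le {α : ℝ} {z : ℂ} (hz : 0 ≤ z.re) {u : ℝ} (hu : 0 < u) :
    ‖symbI α z u‖ ≤ max 2 ‖z‖ * (min (u ^ (1:ℝ)) (u ^ (0:ℝ)) * u ^ (-1 - α)) := by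
  have h0 : 0 ≤ (z * u).re := by simp; positivity
  have h1 := norm_exp_neg_sub_one_le h0
  have h2 : ‖Complex.exp (-(z * u)) - 1‖ ≤ 2 := by
    refine (norm_sub_le _ _).trans ?_
    rw [Complex.norm_exp, norm_one]
    have : rexp (-(z * u)).re ≤ 1 := by
      rw [Real.exp_le_one_iff, Complex.neg_re]; linarith
    linarith
  rw [symbI, norm_mul, Complex.norm_real, Real.norm_of_nonneg (by positivity), ← mul_assoc]
  gcongr
  rw [Real.rpow_one, Real.rpow_zero, mul_min_of_nonneg _ _ (by positivity)]
  refine le_min ?_ ?_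
  · refine h1.trans ?_
    rw [norm_mul, Complex.norm_real, Real.norm_of_nonneg hu.le]
    gcongr
    exact le_max_right _ _
  · rw [mul_one]; exact h2.trans (le_max_left _ _)

lemma measurable_symbI (α : ℝ) (z : ℂ) : Measurable (symbI α z) := by
  unfold symbI; fun_prop

lemma integrableOn_symbI {α : ℝ} (h0 : 0 < α) (h1 : α < 1) {z : ℂ} (hz : 0 ≤ z.re) :
    IntegrableOn (symbI α z) (Ioi 0) := by
  have := (integrableOn_min_rpow (a := 1) (b := 0) h0 h1).const_mul (max 2 ‖z‖)
  refine Integrable.mono' this (measurable_symbI α z).aestronglyMeasurable ?_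
  filter_upwards [ae_restrict_mem measurableSet_Ioi] with u hu
  exact norm_symbI_le hz hu

lemma integral_symb_real {α : ℝ} (h0 : 0 < α) (h1 : α < 1) {x : ℝ} (hx : 0 < x) :
    ∫ u in Ioi (0:ℝ), (rexp (-(x * u)) - 1) * u ^ (-1 - α) = Real.Gamma (-α) * x ^ α := by
  have hi1 : IntegrableOn (fun u : ℝ => (rexp (-(x * u)) - 1) * u ^ (-1 - α)) (Ioi 0) := by
    have := (integrableOn_symbI h0 h1 (z := x) (by simpa using hx.le)).re
    refine IntegrableOn.congr_fun this (fun u hu => ?_) measurableSet_Ioi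
    simp only [symbI, RCLike.re_to_complex, Complex.re_mul_ofReal]
    congr 1
    rw [← Complex.ofReal_mul, ← Complex.ofReal_neg, ← Complex.ofReal_exp, ← Complex.ofReal_one,
      ← Complex.ofReal_sub, Complex.ofReal_re]
  have hi2 : IntegrableOn (fun u : ℝ => u ^ (-α) * rexp (-(x * u))) (Ioi 0) := by
    have := integrableOn_rpow_mul_exp_neg_mul_rpow (s := -α) (p := 1) (b := x) (by linarith) one_pos hx
    simpa using this
  have hG := Real.integral_rpow_mul_exp_neg_mul_Ioi (a := 1 - α) (r := x) (by linarith) hx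
  have key := integral_Ioi_mul_deriv_eq_deriv_mul (a := (0:ℝ)) (a' := (0:ℝ)) (b' := (0:ℝ))
    (u := fun u : ℝ => rexp (-(x * u)) - 1) (u' := fun u : ℝ => -x * rexp (-(x * u)))
    (v := fun u : ℝ => -u ^ (-α) / α) (v' := fun u : ℝ => u ^ (-1 - α)) ?_ ?_ hi1 ?_ ?_ ?_
  · rw [key]
    have : ∀ u : ℝ, -x * rexp (-(x * u)) * (-u ^ (-α) / α) = (x / α) * (u ^ (1 - α - 1) * rexp (-(x * u))) := by
      intro u
      rw [show 1 - α - 1 = -α by ring]; ring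
    simp_rw [this]
    rw [integral_const_mul, hG]
    have hg : Real.Gamma (1 - α) = -α * Real.Gamma (-α) := by
      rw [← Real.Gamma_add_one (by linarith)]; congr 1; ring
    rw [hg, one_div, Real.inv_rpow hx.le, Real.rpow_sub hx, Real.rpow_one]
    field_simp
    ring
  · intro u hu
    have : HasDerivAt (fun u : ℝ => -(x * u)) (-x) u := by
      simpa using ((hasDerivAt_id u).const_mul x).fun_neg
    have := (this.exp).sub_const 1
    convert! this using 1; ring
  · intro u hu
    have := ((Real.hasDerivAt_rpow_const (p := -α) (Or.inl (ne_of_gt hu))).neg).div_const α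
    convert! this using 1
    rw [show -α - 1 = -1 - α by ring]; field_simp
  · have := hi2.const_mul (x / α)
    refine IntegrableOn.congr_fun this (fun u hu => ?_) measurableSet_Ioi
    simp only [Pi.mul_apply]; ring
  · have hl : Tendsto (fun u : ℝ => x / α * u ^ (1 - α)) (𝓝[>] 0) (𝓝 0) := by
      have : Tendsto (fun u : ℝ => x / α * u ^ (1 - α)) (𝓝 0) (𝓝 (x / α * 0 ^ (1 - α))) :=
        ((Real.continuousAt_rpow_const 0 (1 - α) (Or.inr (by linarith))).const_mul _)
      rw [Real.zero_rpow (by linarith), mul_zero] at this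
      exact this.mono_left nhdsWithin_le_nhds
    refine squeeze_zero_norm' ?_ hl
    filter_upwards [self_mem_nhdsWithin] with u hu
    have hu0 : 0 < u := hu
    simp only [Pi.mul_apply, norm_mul, norm_div, norm_neg]
    have h3 : ‖rexp (-(x * u)) - 1‖ ≤ x * u := by
      have h4 := Real.add_one_le_exp (-(x * u))
      have h5 : rexp (-(x * u)) ≤ 1 := by rw [Real.exp_le_one_iff, neg_nonpos]; positivity
      rw [Real.norm_eq_abs, abs_le]; constructor <;> nlinarith [mul_pos hx hu0]
    rw [Real.norm_of_nonneg (by positivity : 0 ≤ u ^ (-α)), Real.norm_of_nonneg h0.le]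
    calc _ ≤ x * u * (u ^ (-α) / α) := by gcongr
      _ = _ := by
        rw [sub_eq_add_neg, Real.rpow_add hu0, Real.rpow_one]; ring
  · have hl : Tendsto (fun u : ℝ => u ^ (-α) / α) atTop (𝓝 0) := by
      simpa using (tendsto_rpow_neg_atTop h0).div_const α
    refine squeeze_zero_norm' ?_ hl
    filter_upwards [eventually_gt_atTop 0] with u hu
    simp only [Pi.mul_apply, norm_mul, norm_div, norm_neg]
    have h3 : ‖rexp (-(x * u)) - 1‖ ≤ 1 := by
      have h5 : rexp (-(x * u)) ≤ 1 := by rw [Real.exp_le_one_iff, neg_nonpos]; positivity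
      rw [Real.norm_eq_abs, abs_le]; constructor <;> linarith [Real.exp_pos (-(x * u))]
    rw [Real.norm_of_nonneg (by positivity : 0 ≤ u ^ (-α)), Real.norm_of_nonneg h0.le]
    calc _ ≤ 1 * (u ^ (-α) / α) := by gcongr
      _ = _ := one_mul _

lemma differentiableOn_symb {α : ℝ} (h0 : 0 < α) (h1 : α < 1) :
    DifferentiableOn ℂ (fun z => ∫ u in Ioi (0:ℝ), symbI α z u) {z | 0 < z.re} := by
  intro z hz
  have hz : 0 < z.re := hz
  refine DifferentiableAt.differentiableWithinAt ?_
  have hb : IntegrableOn (fun u : ℝ => u ^ (-α) * rexp (-(z.re / 2 * u))) (Ioi 0) := by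
    have := integrableOn_rpow_mul_exp_neg_mul_rpow (s := -α) (p := 1) (b := z.re / 2) (by linarith) one_pos (by positivity)
    simpa using this
  have := hasDerivAt_integral_of_dominated_loc_of_deriv_le (μ := volume.restrict (Ioi (0:ℝ)))
    (F := fun w u => symbI α w u) (F' := fun w u => -u * Complex.exp (-(w * u)) * ((u ^ (-1 - α) : ℝ) : ℂ))
    (x₀ := z) (s := Metric.ball z (z.re / 2)) (bound := fun u : ℝ => u ^ (-α) * rexp (-(z.re / 2 * u)))
    (Metric.ball_mem_nhds z (by positivity))
    (Eventually.of_forall fun w => (measurable_symbI α w).aestronglyMeasurable)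
    (integrableOn_symbI h0 h1 hz.le)
    (by apply Measurable.aestronglyMeasurable; fun_prop) ?_ hb ?_
  · exact this.2.differentiableAt
  · filter_upwards [ae_restrict_mem measurableSet_Ioi] with u hu w hw
    have hu0 : 0 < u := hu
    have hw' : z.re / 2 ≤ w.re := by
      have h2 : |(w - z).re| ≤ ‖w - z‖ := Complex.abs_re_le_norm _
      rw [Metric.mem_ball, dist_eq_norm] at hw
      rw [Complex.sub_re] at h2
      have := (abs_le.mp (h2.trans hw.le)).1
      linarith
    rw [norm_mul, norm_mul, norm_neg, Complex.norm_real, Complex.norm_real, Complex.norm_exp,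
      Real.norm_of_nonneg hu0.le, Real.norm_of_nonneg (by positivity)]
    have h3 : u * u ^ (-1 - α) = u ^ (-α) := by
      rw [show -α = 1 + (-1 - α) by ring, Real.rpow_add hu0, Real.rpow_one]
    have h4 : rexp (-(w * (u:ℂ))).re ≤ rexp (-(z.re / 2 * u)) := by
      apply Real.exp_le_exp.mpr
      simp
      gcongr
    calc _ = u ^ (-α) * rexp (-(w * (u:ℂ))).re := by rw [← h3]; ring
      _ ≤ _ := by gcongr
  · filter_upwards [ae_restrict_mem measurableSet_Ioi] with u hu w hw
    have h2 : HasDerivAt (fun w : ℂ => -(w * u)) (-(u:ℂ)) w := by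
      simpa using ((hasDerivAt_id w).mul_const (u:ℂ)).fun_neg
    have := ((h2.cexp).sub_const 1).mul_const ((u ^ (-1 - α) : ℝ) : ℂ)
    convert! this using 1; ring

lemma integral_symb_open {α : ℝ} (h0 : 0 < α) (h1 : α < 1) {z : ℂ} (hz : 0 < z.re) :
    ∫ u in Ioi (0:ℝ), symbI α z u = (Real.Gamma (-α) : ℂ) * z ^ (α : ℂ) := by
  have hopen : IsOpen {z : ℂ | 0 < z.re} := isOpen_lt continuous_const Complex.continuous_re
  have hA := (differentiableOn_symb h0 h1).analyticOnNhd hopen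
  have hB : AnalyticOnNhd ℂ (fun z : ℂ => (Real.Gamma (-α) : ℂ) * z ^ (α : ℂ)) {z : ℂ | 0 < z.re} := by
    apply DifferentiableOn.analyticOnNhd _ hopen
    intro w hw
    refine DifferentiableAt.differentiableWithinAt ?_
    exact ((differentiableAt_id.cpow_const (Or.inl hw))).const_mul _
  have hconn : IsPreconnected {z : ℂ | 0 < z.re} := (convex_halfSpace_re_gt 0).isPreconnected
  refine hA.eqOn_of_preconnected_of_frequently_eq hB hconn (z₀ := 1) (by simp) ?_ hz
  have ht : Tendsto (fun x : ℝ => (x : ℂ)) (𝓝[≠] 1) (𝓝[≠] 1) := by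
    refine tendsto_nhdsWithin_of_tendsto_nhds_of_eventually_within _ ?_ ?_
    · exact (Complex.continuous_ofReal.tendsto' 1 1 (by simp)).mono_left nhdsWithin_le_nhds
    · filter_upwards [self_mem_nhdsWithin] with x hx
      simpa using hx
  refine ht.frequently (Eventually.frequently ?_)
  have : ∀ᶠ x : ℝ in 𝓝[≠] 1, 0 < x := nhdsWithin_le_nhds (lt_mem_nhds one_pos)
  filter_upwards [this] with x hx
  have h2 := integral_symb_real h0 h1 hx
  rw [← Complex.ofReal_cpow hx.le, ← Complex.ofReal_mul, ← h2, ← integral_complex_ofReal]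
  congr 1; ext u
  simp [symbI]

lemma integral_symb {α : ℝ} (h0 : 0 < α) (h1 : α < 1) {z : ℂ} (hz : 0 ≤ z.re) (hz' : z ≠ 0) :
    ∫ u in Ioi (0:ℝ), symbI α z u = (Real.Gamma (-α) : ℂ) * z ^ (α : ℂ) := by
  have hsl : z ∈ Complex.slitPlane := by
    rcases hz.lt_or_eq with h | h
    · exact Or.inl h
    · refine Or.inr fun him => hz' (Complex.ext h.symm him)
  have hε : Tendsto (fun n : ℕ => z + ((1 / ((n:ℝ) + 1) : ℝ) : ℂ)) atTop (𝓝 z) := by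
    have := (Complex.continuous_ofReal.tendsto 0).comp tendsto_one_div_add_atTop_nhds_zero_nat
    simpa using this.const_add z
  have hL : Tendsto (fun n : ℕ => ∫ u in Ioi (0:ℝ), symbI α (z + ((1 / ((n:ℝ) + 1) : ℝ) : ℂ)) u) atTop
      (𝓝 (∫ u in Ioi (0:ℝ), symbI α z u)) := by
    refine tendsto_integral_of_dominated_convergence
      (fun u => (2 + ‖z‖) * (min (u ^ (1:ℝ)) (u ^ (0:ℝ)) * u ^ (-1 - α)))
      (fun n => (measurable_symbI α _).aestronglyMeasurable)
      ((integrableOn_min_rpow h0 h1).const_mul _) ?_ ?_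
    · intro n
      filter_upwards [ae_restrict_mem measurableSet_Ioi] with u hu
      have hu0 : 0 < u := hu
      have hpos : 0 < 1 / ((n:ℝ) + 1) := by positivity
      have hle : 1 / ((n:ℝ) + 1) ≤ 1 := by
        rw [div_le_one (by positivity)]; linarith [Nat.cast_nonneg (α := ℝ) n]
      refine (norm_symbI_le (by rw [Complex.add_re, Complex.ofReal_re]; linarith) hu).trans ?_
      gcongr
      refine max_le (by linarith [norm_nonneg z]) ?_
      refine (norm_add_le _ _).trans ?_
      rw [Complex.norm_real, Real.norm_of_nonneg hpos.le]
      linarith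
    · refine Eventually.of_forall fun u => ?_
      unfold symbI
      refine Tendsto.mul_const _ (Tendsto.sub_const ?_ _)
      refine (Complex.continuous_exp.tendsto _).comp ?_
      exact (hε.mul_const _).neg
  have hR : Tendsto (fun n : ℕ => (Real.Gamma (-α) : ℂ) * (z + ((1 / ((n:ℝ) + 1) : ℝ) : ℂ)) ^ (α : ℂ)) atTop
      (𝓝 ((Real.Gamma (-α) : ℂ) * z ^ (α : ℂ))) := by
    refine Tendsto.const_mul _ ?_
    exact ((continuousAt_cpow_const hsl).tendsto).comp hε
  refine tendsto_nhds_unique hL (hR.congr fun n => ?_)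
  rw [integral_symb_open h0 h1]
  have hpos : 0 < 1 / ((n:ℝ) + 1) := by positivity
  rw [Complex.add_re, Complex.ofReal_re]; linarith


lemma pos_mul_cpow {r : ℝ} (hr : 0 < r) {z : ℂ} (hz : z ≠ 0) (a : ℂ) :
    ((r : ℂ) * z) ^ a = (r : ℂ) ^ a * z ^ a := by
  have hr' : (r : ℂ) ≠ 0 := by exact_mod_cast hr.ne'
  rw [Complex.cpow_def_of_ne_zero (mul_ne_zero hr' hz), Complex.log_ofReal_mul hr hz,
    Complex.cpow_def_of_ne_zero hr', Complex.cpow_def_of_ne_zero hz, ← Complex.exp_add,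
    Complex.ofReal_log hr.le]
  congr 1; ring

lemma I_cpow_of_real {v α : ℝ} (hv : v ≠ 0) :
    (-(Complex.I * v)) ^ (α : ℂ) = ((|v| ^ α : ℝ) : ℂ) *
      ((Real.cos (π * α / 2) : ℝ) - Complex.I * ((Real.sign v : ℝ) : ℂ) * ((Real.sin (π * α / 2) : ℝ) : ℂ)) := by
  have hpos : 0 < |v| := abs_pos.mpr hv
  rcases hv.lt_or_gt with h | h
  · have e1 : (-(Complex.I * v)) = ((|v| : ℝ) : ℂ) * Complex.I := by
      rw [abs_of_neg h]; push_cast; ring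
    rw [e1, pos_mul_cpow hpos Complex.I_ne_zero, Real.sign_of_neg h, Complex.ofReal_cpow hpos.le]
    congr 1
    rw [Complex.cpow_def_of_ne_zero Complex.I_ne_zero, Complex.log_I]
    rw [show (π / 2 * Complex.I * α : ℂ) = ((π * α / 2 : ℝ) : ℂ) * Complex.I by push_cast; ring,
      Complex.exp_mul_I, ← Complex.ofReal_cos, ← Complex.ofReal_sin]
    push_cast; ring
  · have e1 : (-(Complex.I * v)) = ((|v| : ℝ) : ℂ) * (-Complex.I) := by
      rw [abs_of_pos h]; ring
    rw [e1, pos_mul_cpow hpos (neg_ne_zero.mpr Complex.I_ne_zero), Real.sign_of_pos h, Complex.ofReal_cpow hpos.le]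
    congr 1
    rw [Complex.cpow_def_of_ne_zero (neg_ne_zero.mpr Complex.I_ne_zero), Complex.log_neg_I]
    rw [show (-(π / 2) * Complex.I * α : ℂ) = ((-(π * α / 2) : ℝ) : ℂ) * Complex.I by push_cast; ring,
      Complex.exp_mul_I, ← Complex.ofReal_cos, ← Complex.ofReal_sin, Real.cos_neg, Real.sin_neg]
    push_cast; ring

lemma integral_cos_sub_one_rpow {α : ℝ} (h0 : 0 < α) (h1 : α < 1) :
    ∫ u in Ioi (0:ℝ), (Real.cos u - 1) * u ^ (-1 - α) = Real.Gamma (-α) * Real.cos (π * α / 2) := by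
  have hz : (0:ℝ) ≤ (-(Complex.I * ((1:ℝ):ℂ))).re := by simp
  have hI := integrableOn_symbI h0 h1 hz
  have h := integral_symb h0 h1 hz (by simp)
  rw [I_cpow_of_real one_ne_zero] at h
  have h2 := congrArg Complex.re h
  rw [← RCLike.re_to_complex, ← integral_re hI] at h2
  have e : ∀ u : ℝ, RCLike.re (symbI α (-(Complex.I * ((1:ℝ):ℂ))) u) = (Real.cos u - 1) * u ^ (-1 - α) := by
    intro u
    simp only [symbI, RCLike.re_to_complex, Complex.re_mul_ofReal]
    congr 1
    rw [show (-(-(Complex.I * ((1:ℝ):ℂ)) * (u:ℂ))) = (u:ℂ) * Complex.I by push_cast; ring, Complex.sub_re,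
      Complex.exp_ofReal_mul_I_re]
    simp
  simp_rw [e] at h2
  rw [h2]
  rw [Complex.re_ofReal_mul, Complex.re_ofReal_mul, Complex.sub_re, Complex.ofReal_re, mul_assoc,
    Complex.I_mul_re, ← Complex.ofReal_mul, Complex.ofReal_im]
  simp

lemma gamma_limit : Tendsto (fun n : ℕ => Real.Gamma (-(1 - 1 / ((n:ℝ) + 2))) * Real.cos (π * (1 - 1 / ((n:ℝ) + 2)) / 2))
    atTop (𝓝 (-(π / 2))) := by
  have hε : Tendsto (fun n : ℕ => 1 / ((n:ℝ) + 2)) atTop (𝓝 0) := by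
    refine tendsto_const_nhds.div_atTop ?_
    exact tendsto_natCast_atTop_atTop.atTop_add tendsto_const_nhds
  have hd : HasDerivAt (fun e : ℝ => Real.sin (π / 2 * e)) (π / 2) 0 := by
    have := ((hasDerivAt_id (0:ℝ)).const_mul (π / 2)).sin
    simpa using this
  have hs : Tendsto (fun n : ℕ => (1 / ((n:ℝ) + 2))⁻¹ * Real.sin (π / 2 * (1 / ((n:ℝ) + 2)))) atTop (𝓝 (π / 2)) := by
    have h3 := hasDerivAt_iff_tendsto_slope_zero.mp hd
    have h4 : Tendsto (fun n : ℕ => 1 / ((n:ℝ) + 2)) atTop (𝓝[≠] 0) := by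
      refine tendsto_nhdsWithin_of_tendsto_nhds_of_eventually_within _ hε (Eventually.of_forall fun n => ?_)
      have : 0 < 1 / ((n:ℝ) + 2) := by positivity
      exact this.ne'
    refine (h3.comp h4).congr fun n => ?_
    simp
  have hg : Tendsto (fun n : ℕ => Real.Gamma (1 + 1 / ((n:ℝ) + 2))) atTop (𝓝 1) := by
    have h5 : ContinuousAt Real.Gamma 1 :=
      (Real.differentiableAt_Gamma (fun m => by have : (0:ℝ) ≤ m := Nat.cast_nonneg m; linarith)).continuousAt
    have h6 : Tendsto (fun n : ℕ => 1 + 1 / ((n:ℝ) + 2)) atTop (𝓝 1) := by simpa using hε.const_add 1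
    have := h5.tendsto.comp h6
    rwa [Real.Gamma_one] at this
  have hα : Tendsto (fun n : ℕ => (1 - 1 / ((n:ℝ) + 2))) atTop (𝓝 1) := by simpa using hε.const_sub 1
  have := ((hg.div hα one_ne_zero).mul hs).neg
  rw [div_one, one_mul] at this
  refine this.congr fun n => ?_
  have hpos : 0 < 1 / ((n:ℝ) + 2) := by positivity
  have hlt : 1 / ((n:ℝ) + 2) < 1 := by
    rw [div_lt_one (by positivity)]; linarith [Nat.cast_nonneg (α := ℝ) n]
  simp only [Pi.div_apply]
  generalize 1 / ((n:ℝ) + 2) = e at hpos hlt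
  have g1 : Real.Gamma (1 + e) = e * (-(1 - e) * Real.Gamma (-(1 - e))) := by
    rw [add_comm, Real.Gamma_add_one hpos.ne', ← Real.Gamma_add_one (by linarith : -(1 - e) ≠ 0)]
    congr 2; ring
  have g2 : Real.cos (π * (1 - e) / 2) = Real.sin (π / 2 * e) := by
    rw [← Real.cos_pi_div_two_sub]; congr 1; ring
  rw [g1, g2]
  have : 1 - e ≠ 0 := by linarith
  field_simp

lemma one_sub_cos_le (u : ℝ) : |Real.cos u - 1| ≤ 2 * min (|u| ^ (2:ℝ)) 1 := by
  have h1 := Real.one_sub_sq_div_two_le_cos (x := u)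
  have h2 := Real.cos_le_one u
  have h3 := Real.neg_one_le_cos u
  rw [abs_of_nonpos (by linarith), mul_min_of_nonneg _ _ (by norm_num)]
  refine le_min ?_ (by linarith)
  rw [show (2:ℝ) = ((2:ℕ):ℝ) by norm_num, Real.rpow_natCast, sq_abs]
  push_cast; nlinarith [sq_nonneg u]

lemma integral_cos_sub_one_sq :
    IntegrableOn (fun u : ℝ => (Real.cos u - 1) * u ^ (-2:ℝ)) (Ioi 0) ∧
    ∫ u in Ioi (0:ℝ), (Real.cos u - 1) * u ^ (-2:ℝ) = -(π / 2) := by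
  have hInteg : IntegrableOn (fun u : ℝ => 2 * (min (u ^ (3/2:ℝ)) (u ^ (0:ℝ)) * u ^ (-1 - (1/2:ℝ)))) (Ioi 0) :=
    (integrableOn_min_rpow (by norm_num) (by norm_num)).const_mul 2
  have hbd : ∀ a : ℝ, 1/2 ≤ a → a ≤ 1 → ∀ u : ℝ, 0 < u → ‖(Real.cos u - 1) * u ^ (-1 - a)‖ ≤
      2 * (min (u ^ (3/2:ℝ)) (u ^ (0:ℝ)) * u ^ (-1 - (1/2:ℝ))) := by
    intro a ha ha' u hu
    have h1 := one_sub_cos_le u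
    rw [abs_of_pos hu] at h1
    rw [norm_mul, Real.norm_eq_abs, Real.norm_of_nonneg (by positivity : 0 ≤ u ^ (-1 - a))]
    refine (mul_le_mul_of_nonneg_right h1 (by positivity)).trans ?_
    rw [mul_assoc]
    refine mul_le_mul_of_nonneg_left ?_ (by norm_num)
    rcases le_total u 1 with h | h
    · have : min (u ^ (3/2:ℝ)) (u ^ (0:ℝ)) = u ^ (3/2:ℝ) :=
        min_eq_left (Real.rpow_le_rpow_of_exponent_ge hu h (by norm_num))
      rw [this, ← Real.rpow_add hu]
      refine (mul_le_mul_of_nonneg_right (min_le_left _ _) (by positivity)).trans ?_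
      rw [← Real.rpow_add hu]
      exact Real.rpow_le_rpow_of_exponent_ge hu h (by linarith)
    · have : min (u ^ (3/2:ℝ)) (u ^ (0:ℝ)) = u ^ (0:ℝ) :=
        min_eq_right (Real.rpow_le_rpow_of_exponent_le h (by norm_num))
      rw [this, ← Real.rpow_add hu]
      refine (mul_le_mul_of_nonneg_right (min_le_right _ _) (by positivity)).trans ?_
      rw [one_mul]
      exact Real.rpow_le_rpow_of_exponent_le h (by linarith)
  have hm : ∀ a : ℝ, Measurable (fun u : ℝ => (Real.cos u - 1) * u ^ a) := fun a => by fun_prop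
  have e2 : (-2:ℝ) = -1 - 1 := by norm_num
  have hI : IntegrableOn (fun u : ℝ => (Real.cos u - 1) * u ^ (-2:ℝ)) (Ioi 0) := by
    refine Integrable.mono' hInteg (hm _).aestronglyMeasurable ?_
    filter_upwards [ae_restrict_mem measurableSet_Ioi] with u hu
    rw [e2]; exact hbd 1 (by norm_num) le_rfl u hu
  refine ⟨hI, ?_⟩
  have hε : Tendsto (fun n : ℕ => 1 / ((n:ℝ) + 2)) atTop (𝓝 0) := by
    refine tendsto_const_nhds.div_atTop ?_
    exact tendsto_natCast_atTop_atTop.atTop_add tendsto_const_nhds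
  have hα : Tendsto (fun n : ℕ => -1 - (1 - 1 / ((n:ℝ) + 2))) atTop (𝓝 (-2)) := by
    rw [e2]; simpa using (hε.const_sub 1).const_sub (-1)
  have hn : ∀ n : ℕ, 0 < 1 / ((n:ℝ) + 2) ∧ 1 / ((n:ℝ) + 2) ≤ 1/2 := by
    intro n
    refine ⟨by positivity, ?_⟩
    apply one_div_le_one_div_of_le (by norm_num); linarith [Nat.cast_nonneg (α := ℝ) n]
  have hL : Tendsto (fun n : ℕ => ∫ u in Ioi (0:ℝ), (Real.cos u - 1) * u ^ (-1 - (1 - 1 / ((n:ℝ) + 2)))) atTop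
      (𝓝 (∫ u in Ioi (0:ℝ), (Real.cos u - 1) * u ^ (-2:ℝ))) := by
    refine tendsto_integral_of_dominated_convergence _ (fun n => (hm _).aestronglyMeasurable) hInteg ?_ ?_
    · intro n
      filter_upwards [ae_restrict_mem measurableSet_Ioi] with u hu
      exact hbd _ (by linarith [(hn n).2]) (by linarith [(hn n).1]) u hu
    · filter_upwards [ae_restrict_mem measurableSet_Ioi] with u hu
      refine Tendsto.const_mul _ ?_
      exact ((Real.continuous_const_rpow (ne_of_gt hu)).tendsto _).comp hα
  refine tendsto_nhds_unique hL (gamma_limit.congr fun n => ?_)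
  rw [integral_cos_sub_one_rpow]
  · linarith [(hn n).2]
  · linarith [(hn n).1]


/-- The Lévy exponent. -/
def psi (α δ l : ℝ) : ℂ :=
  if α = 1 then ((|l| : ℝ) : ℂ)
  else ((|l| ^ α : ℝ) : ℂ) *
    (1 - Complex.I * (δ : ℂ) * ((Real.sign l : ℝ) : ℂ) * ((Real.tan (π * α / 2) : ℝ) : ℂ))

/-- (Possibly symmetrized) increment of the exponential. -/
def qf (c v u : ℝ) : ℂ :=
  (Complex.exp (v * u * Complex.I) - 1) + c * (Complex.exp (-(v * u * Complex.I)) - 1)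

/-- The data needed about the (symmetrized) Lévy density. -/
structure LevyData (α : ℝ) (ψ : ℝ → ℂ) (c : ℝ) (N : ℝ → ℝ) : Prop where
  meas : Measurable N
  bound : ∃ B : ℝ, 0 ≤ B ∧ ∀ u, |N u| ≤ B * |u| ^ (-1 - α)
  hom : ∀ r : ℝ, 0 < r → ∀ u, N (r * u) = r ^ (-1 - α) * N u
  qint : ∀ v, Integrable (fun u => qf c v u * (N u : ℂ))
  qval : ∀ v, ∫ u, qf c v u * (N u : ℂ) = -ψ v

lemma stableCF_one (α δ l : ℝ) : stableCF α δ 1 l = Complex.exp (-psi α δ l) := by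
  unfold stableCF psi
  split_ifs
  · simp
  · congr 1; push_cast; ring

lemma psi_smul {α : ℝ} (hα : 0 < α) (δ : ℝ) {r : ℝ} (hr : 0 ≤ r) (l : ℝ) :
    psi α δ (r * l) = ((r ^ α : ℝ) : ℂ) * psi α δ l := by
  unfold psi
  split_ifs with h
  · subst h; simp [abs_mul, abs_of_nonneg hr]
  · rcases hr.eq_or_lt with h0 | h0
    · rw [← h0]; simp [Real.zero_rpow hα.ne']
    · have hs : Real.sign (r * l) = Real.sign l := by
        rcases lt_trichotomy l 0 with g | g | g
        · rw [Real.sign_of_neg g, Real.sign_of_neg (mul_neg_of_pos_of_neg h0 g)]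
        · rw [g, mul_zero]
        · rw [Real.sign_of_pos g, Real.sign_of_pos (mul_pos h0 g)]
      rw [abs_mul, Real.mul_rpow (abs_nonneg _) (abs_nonneg _), abs_of_pos h0, hs]
      push_cast; ring

lemma psi_re_nonneg (α δ l : ℝ) : 0 ≤ (psi α δ l).re := by
  unfold psi
  split_ifs with h
  · simp
  · rw [Complex.re_ofReal_mul]
    refine mul_nonneg (by positivity) ?_
    rw [Complex.sub_re, mul_assoc, mul_assoc, Complex.I_mul_re, ← Complex.ofReal_mul, ← Complex.ofReal_mul,
      Complex.ofReal_im]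
    simp

lemma psi_zero {α : ℝ} (hα : 0 < α) (δ : ℝ) : psi α δ 0 = 0 := by
  unfold psi; simp [Real.zero_rpow hα.ne']

lemma levyData_lt {α δ : ℝ} (h0 : 0 < α) (h1 : α < 1) :
    LevyData α (psi α δ) 0 (nuDens α δ) := by
  have hpos : ∀ u : ℝ, 0 < u → nuDens α δ u = dconst α * ((1 + δ) / 2) * u ^ (-1 - α) := by
    intro u hu; simp [nuDens, hu]; ring
  have hneg : ∀ u : ℝ, 0 < u → nuDens α δ (-u) = dconst α * ((1 - δ) / 2) * u ^ (-1 - α) := by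
    intro u hu; simp [nuDens, hu, hu.le, hu.not_gt, abs_of_pos hu]; ring
  have hzero : nuDens α δ 0 = 0 := by simp [nuDens]
  have hcos : 0 < Real.cos (π * α / 2) := by
    apply Real.cos_pos_of_mem_Ioo; constructor <;> nlinarith [Real.pi_pos]
  have hG : Real.Gamma (-α) ≠ 0 := by
    apply Real.Gamma_ne_zero
    intro m hm
    have hm' : α = m := by linarith
    have : (0:ℝ) < m ∧ (m:ℝ) < 1 := by rw [← hm']; exact ⟨h0, h1⟩
    have h3 : 0 < m := by exact_mod_cast this.1
    have h4 : m < 1 := by exact_mod_cast this.2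
    omega
  have e1 : ∀ v u : ℝ, u ∈ Ioi (0:ℝ) → qf 0 v u * (nuDens α δ u : ℂ) =
      ((dconst α * ((1 + δ) / 2) : ℝ) : ℂ) * symbI α (-(Complex.I * v)) u := by
    intro v u hu
    rw [hpos u hu, qf, symbI, show (v * u * Complex.I : ℂ) = -(-(Complex.I * v) * u) by ring]
    push_cast; ring
  have e2 : ∀ v u : ℝ, u ∈ Ioi (0:ℝ) → qf 0 v (-u) * (nuDens α δ (-u) : ℂ) =
      ((dconst α * ((1 - δ) / 2) : ℝ) : ℂ) * symbI α (-(Complex.I * ((-v : ℝ) : ℂ))) u := by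
    intro v u hu
    rw [hneg u hu, qf, symbI, show (v * ((-u : ℝ) : ℂ) * Complex.I : ℂ) = -(-(Complex.I * ((-v : ℝ) : ℂ)) * u) by push_cast; ring]
    push_cast; ring
  have hre : ∀ v : ℝ, 0 ≤ (-(Complex.I * (v:ℂ))).re := by intro v; simp
  have i1 : ∀ v : ℝ, IntegrableOn (fun u => qf 0 v u * (nuDens α δ u : ℂ)) (Ioi 0) := fun v =>
    IntegrableOn.congr_fun ((integrableOn_symbI h0 h1 (hre v)).const_mul _) (fun u hu => (e1 v u hu).symm) measurableSet_Ioi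
  have i2 : ∀ v : ℝ, IntegrableOn (fun u => qf 0 v (-u) * (nuDens α δ (-u) : ℂ)) (Ioi 0) := fun v =>
    IntegrableOn.congr_fun ((integrableOn_symbI h0 h1 (hre (-v))).const_mul _) (fun u hu => (e2 v u hu).symm) measurableSet_Ioi
  refine ⟨?_, ?_, ?_, ?_, ?_⟩
  · unfold nuDens
    refine Measurable.const_mul ?_ _
    refine Measurable.ite measurableSet_Ioi (by fun_prop) ?_
    exact Measurable.ite measurableSet_Iio (by fun_prop) (by fun_prop)
  · refine ⟨|dconst α| * (|(1 + δ) / 2| + |(1 - δ) / 2|), by positivity, fun u => ?_⟩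
    rcases lt_trichotomy u 0 with h | h | h
    · have := hneg (-u) (by linarith)
      rw [neg_neg] at this
      have hu : 0 < -u := by linarith
      rw [this, abs_of_neg h, abs_mul, abs_mul, abs_of_nonneg (by positivity : 0 ≤ (-u) ^ (-1 - α))]
      gcongr
      linarith [abs_nonneg ((1 + δ) / 2)]
    · rw [h, hzero, abs_zero]; positivity
    · rw [hpos u h, abs_of_pos h, abs_mul, abs_mul, abs_of_nonneg (by positivity : 0 ≤ u ^ (-1 - α))]
      gcongr
      linarith [abs_nonneg ((1 - δ) / 2)]
  · intro r hr u
    rcases lt_trichotomy u 0 with h | h | h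
    · have a1 := hneg (-u) (by linarith)
      have a2 := hneg (r * (-u)) (mul_pos hr (by linarith))
      rw [neg_neg] at a1
      rw [show -(r * -u) = r * u by ring] at a2
      rw [a1, a2, Real.mul_rpow hr.le (by linarith)]; ring
    · rw [h, mul_zero, hzero, mul_zero]
    · rw [hpos u h, hpos _ (mul_pos hr h), Real.mul_rpow hr.le h.le]; ring
  · exact fun v => (integrable_of_halves (i1 v) (i2 v)).1
  · intro v
    rw [(integrable_of_halves (i1 v) (i2 v)).2]
    rcases eq_or_ne v 0 with hv | hv
    · subst hv; simp [qf, psi_zero h0]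
    rw [setIntegral_congr_fun measurableSet_Ioi (e1 v), setIntegral_congr_fun measurableSet_Ioi (e2 v)]
    have hv' : (v:ℂ) ≠ 0 := by exact_mod_cast hv
    rw [integral_const_mul, integral_const_mul, integral_symb h0 h1 (hre v) (by simp [hv']),
      integral_symb h0 h1 (hre (-v)) (by simp [hv']), I_cpow_of_real hv, I_cpow_of_real (neg_ne_zero.mpr hv),
      Real.sign_neg, abs_neg, psi, if_neg h1.ne, dconst, if_neg h1.ne, Real.tan_eq_sin_div_cos]
    have hc' : ((Real.cos (π * α / 2) : ℝ) : ℂ) ≠ 0 := by exact_mod_cast hcos.ne'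
    have hG' : ((Real.Gamma (-α) : ℝ) : ℂ) ≠ 0 := by exact_mod_cast hG
    generalize Real.cos (π * α / 2) = C at *
    generalize Real.sin (π * α / 2) = S at *
    generalize Real.Gamma (-α) = G at *
    push_cast
    field_simp
    ring

lemma levyData_one (δ : ℝ) : LevyData 1 (psi 1 δ) 1 (fun u => 1 / (2 * (π * u ^ 2))) := by
  have hq : ∀ v u : ℝ, qf 1 v u * ((1 / (2 * (π * u ^ 2)) : ℝ) : ℂ) =
      (((Real.cos (v * u) - 1) * (1 / (π * u ^ 2)) : ℝ) : ℂ) := by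
    intro v u
    have : qf 1 v u = ((2 * (Real.cos (v * u) - 1) : ℝ) : ℂ) := by
      rw [qf, show (-(v * u * Complex.I) : ℂ) = ((-(v * u) : ℝ) : ℂ) * Complex.I by push_cast; ring,
        show ((v:ℂ) * u * Complex.I) = (((v * u) : ℝ) : ℂ) * Complex.I by push_cast; ring,
        Complex.exp_mul_I, Complex.exp_mul_I, ← Complex.ofReal_cos, ← Complex.ofReal_sin, ← Complex.ofReal_cos, ← Complex.ofReal_sin,
        Real.cos_neg, Real.sin_neg]
      push_cast; ring
    rw [this, ← Complex.ofReal_mul]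
    congr 1
    rcases eq_or_ne u 0 with h | h
    · simp [h]
    · field_simp
  have hbase : Integrable (fun u : ℝ => (Real.cos u - 1) * (1 / (π * u ^ 2))) ∧
      ∫ u : ℝ, (Real.cos u - 1) * (1 / (π * u ^ 2)) = -1 := by
    obtain ⟨hI, hV⟩ := integral_cos_sub_one_sq
    have e : ∀ u ∈ Ioi (0:ℝ), (1 / π) * ((Real.cos u - 1) * u ^ (-2:ℝ)) = (Real.cos u - 1) * (1 / (π * u ^ 2)) := by
      intro u hu
      have hu : 0 < u := hu
      rw [Real.rpow_neg hu.le, show (2:ℝ) = ((2:ℕ):ℝ) by norm_num, Real.rpow_natCast]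
      field_simp
    have j1 : IntegrableOn (fun u : ℝ => (Real.cos u - 1) * (1 / (π * u ^ 2))) (Ioi 0) :=
      IntegrableOn.congr_fun (hI.const_mul (1 / π)) e measurableSet_Ioi
    have j2 : IntegrableOn (fun u : ℝ => (Real.cos (-u) - 1) * (1 / (π * (-u) ^ 2))) (Ioi 0) := by
      simpa only [Real.cos_neg, neg_sq] using j1
    obtain ⟨k1, k2⟩ := integrable_of_halves j1 j2
    refine ⟨k1, k2.trans ?_⟩
    simp only [Real.cos_neg, neg_sq]
    rw [← setIntegral_congr_fun measurableSet_Ioi e, integral_const_mul, hV]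
    field_simp; norm_num
  have hv : ∀ v : ℝ, Integrable (fun u : ℝ => (Real.cos (v * u) - 1) * (1 / (π * u ^ 2))) ∧
      ∫ u : ℝ, (Real.cos (v * u) - 1) * (1 / (π * u ^ 2)) = -|v| := by
    intro v
    rcases eq_or_ne v 0 with h | h
    · simp [h]
    have e : ∀ u : ℝ, v ^ 2 * ((Real.cos (v * u) - 1) * (1 / (π * (v * u) ^ 2))) = (Real.cos (v * u) - 1) * (1 / (π * u ^ 2)) := by
      intro u
      rcases eq_or_ne u 0 with h' | h'
      · simp [h']
      · field_simp
    constructor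
    · have := (hbase.1.comp_mul_left' h).const_mul (v ^ 2)
      exact this.congr (Eventually.of_forall e)
    · simp_rw [← e]
      rw [integral_const_mul, Measure.integral_comp_mul_left (fun u : ℝ => (Real.cos u - 1) * (1 / (π * u ^ 2))), hbase.2]
      rw [abs_inv, ← sq_abs v, smul_eq_mul]
      have : |v| ≠ 0 := abs_ne_zero.mpr h
      field_simp
  refine ⟨by fun_prop, ?_, ?_, ?_, ?_⟩
  · refine ⟨1 / (2 * π), by positivity, fun u => ?_⟩
    rw [abs_of_nonneg (by positivity), show (-1 - 1 : ℝ) = -((2:ℕ):ℝ) by norm_num, Real.rpow_neg (abs_nonneg _),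
      Real.rpow_natCast, sq_abs]
    refine le_of_eq ?_
    rw [← mul_assoc, one_div, mul_inv, one_div]
  · intro r hr u
    rw [show (-1 - 1 : ℝ) = -((2:ℕ):ℝ) by norm_num, Real.rpow_neg hr.le, Real.rpow_natCast]
    rcases eq_or_ne u 0 with h | h
    · simp [h]
    · field_simp
  · intro v
    simp_rw [hq]
    exact (hv v).1.ofReal
  · intro v
    simp_rw [hq]
    rw [integral_complex_ofReal, (hv v).2, psi, if_pos rfl]
    push_cast; rfl

set_option linter.unusedSectionVars false
set_option linter.unusedVariables false

/-- scale factor -/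
def sg (α t : ℝ) : ℝ := (1 - Real.exp (-t)) ^ (1/α)
/-- contraction factor -/
def ee (α t : ℝ) : ℝ := Real.exp (-t/α)

/-- the class `C * H_β` -/
def memC (β C : ℝ) (h : ℝ → ℝ) : Prop := ∀ x y : ℝ, |h x - h y| ≤ C * min |x - y| (|x - y| ^ β)

/-- centered semigroup -/
def GG (α : ℝ) (μ : Measure ℝ) (h : ℝ → ℝ) (t x : ℝ) : ℝ :=
  ∫ y, (h (sg α t * y + ee α t * x) - h y) ∂μ

/-- spatial derivative of the semigroup -/
def GD (α : ℝ) (μ : Measure ℝ) (h : ℝ → ℝ) (t x : ℝ) : ℝ :=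
  ee α t * ∫ y, deriv h (sg α t * y + ee α t * x) ∂μ

/-- the Stein solution -/
def FF (α : ℝ) (μ : Measure ℝ) (h : ℝ → ℝ) (x : ℝ) : ℝ :=
  -∫ t in Ioi (0:ℝ), GG α μ h t x

/-- standing assumptions -/
structure Setup (α β : ℝ) (μ : Measure ℝ) : Prop where
  a0 : 0 < α
  a1 : α ≤ 1
  b0 : 0 < β
  ba : β < α
  mom : Integrable (fun y => |y| ^ β) μ
  ac : μ ≪ volume

lemma memC.nonneg {β C : ℝ} {h : ℝ → ℝ} (H : memC β C h) : 0 ≤ C := by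
  have := H 0 1
  simp at this
  exact (abs_nonneg _).trans this

lemma memC.lip {β C : ℝ} {h : ℝ → ℝ} (H : memC β C h) : LipschitzWith (Real.toNNReal C) h := by
  refine LipschitzWith.of_dist_le_mul fun x y => ?_
  rw [Real.dist_eq, Real.dist_eq, Real.coe_toNNReal _ H.nonneg]
  exact (H x y).trans (mul_le_mul_of_nonneg_left (min_le_left _ _) H.nonneg)

lemma memC.cont {β C : ℝ} {h : ℝ → ℝ} (H : memC β C h) : Continuous h := H.lip.continuous

lemma memC.le1 {β C : ℝ} {h : ℝ → ℝ} (H : memC β C h) (x y : ℝ) : |h x - h y| ≤ C * |x - y| :=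
  (H x y).trans (mul_le_mul_of_nonneg_left (min_le_left _ _) H.nonneg)

lemma memC.leb {β C : ℝ} {h : ℝ → ℝ} (H : memC β C h) (x y : ℝ) : |h x - h y| ≤ C * |x - y| ^ β :=
  (H x y).trans (mul_le_mul_of_nonneg_left (min_le_right _ _) H.nonneg)

lemma memC.add {β C C' : ℝ} {h h' : ℝ → ℝ} (H : memC β C h) (H' : memC β C' h') :
    memC β (C + C') (fun x => h x + h' x) := by
  intro x y
  rw [add_mul, show h x + h' x - (h y + h' y) = (h x - h y) + (h' x - h' y) by ring]
  exact (abs_add_le _ _).trans (add_le_add (H x y) (H' x y))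

lemma memC.mono {β C C' : ℝ} {h : ℝ → ℝ} (H : memC β C h) (hC : C ≤ C') : memC β C' h := by
  intro x y
  exact (H x y).trans (mul_le_mul_of_nonneg_right hC (by positivity))

lemma sg_cont (α : ℝ) (hα : 0 < α) : Continuous (sg α) := by
  unfold sg
  exact (by fun_prop : Continuous fun t : ℝ => 1 - Real.exp (-t)).rpow_const
    (fun t => Or.inr (by positivity))

lemma ee_cont (α : ℝ) : Continuous (ee α) := by
  unfold ee; fun_prop

lemma ee_pos (α t : ℝ) : 0 < ee α t := Real.exp_pos _

lemma ee_le {α t : ℝ} (h0 : 0 < α) (h1 : α ≤ 1) (ht : 0 ≤ t) : ee α t ≤ Real.exp (-t) := by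
  unfold ee
  apply Real.exp_le_exp.mpr
  rw [div_le_iff₀ h0]; nlinarith

lemma sg_pos {α t : ℝ} (ht : 0 < t) : 0 < sg α t := by
  unfold sg
  have : Real.exp (-t) < 1 := by rw [Real.exp_lt_one_iff]; linarith
  apply Real.rpow_pos_of_pos; linarith

lemma sg_le_one {α t : ℝ} (h0 : 0 < α) (ht : 0 ≤ t) : sg α t ≤ 1 := by
  unfold sg
  have : Real.exp (-t) ≤ 1 := by rw [Real.exp_le_one_iff]; linarith
  apply Real.rpow_le_one (by linarith) (by linarith [Real.exp_pos (-t)]) (by positivity)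

lemma one_sub_sg_le {α t : ℝ} (h0 : 0 < α) (h1 : α ≤ 1) (ht : 0 ≤ t) :
    1 - sg α t ≤ Real.exp (-t) / α := by
  unfold sg
  have : Real.exp (-t) ≤ 1 := by rw [Real.exp_le_one_iff]; linarith
  have := one_add_mul_self_le_rpow_one_add (s := -Real.exp (-t)) (by linarith) (p := 1/α)
    (by rw [le_div_iff₀ h0]; linarith)
  rw [show 1 + -Real.exp (-t) = 1 - Real.exp (-t) by ring] at this
  have e : 1 / α * -Real.exp (-t) = -(Real.exp (-t) / α) := by ring
  linarith

lemma ee_rpow_le {α β t : ℝ} (h0 : 0 < α) (h1 : α ≤ 1) (hb : 0 ≤ β) (ht : 0 ≤ t) :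
    ee α t ^ β ≤ Real.exp (-β * t) := by
  calc ee α t ^ β ≤ Real.exp (-t) ^ β := Real.rpow_le_rpow (ee_pos _ _).le (ee_le h0 h1 ht) hb
    _ = _ := by rw [← Real.exp_mul]; congr 1; ring

section
variable {α β : ℝ} {μ : Measure ℝ} [IsProbabilityMeasure μ]

lemma Setup.b1 (S : Setup α β μ) : β < 1 := S.ba.trans_le S.a1

/-- pointwise majorant -/
lemma Setup.ptw (S : Setup α β μ) {C : ℝ} {h : ℝ → ℝ} (H : memC β C h) {t : ℝ} (ht : 0 ≤ t) (x y : ℝ) :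
    |h (sg α t * y + ee α t * x) - h y| ≤ C * Real.exp (-β * t) * (α⁻¹ ^ β * |y| ^ β + |x| ^ β) := by
  have h0 := S.a0
  have e1 : (0:ℝ) ≤ 1 - sg α t := by linarith [sg_le_one h0 ht]
  have e2 := one_sub_sg_le h0 S.a1 ht
  have b0 := S.b0
  have e3 : |sg α t * y + ee α t * x - y| ≤ Real.exp (-t) * (α⁻¹ * |y|) + Real.exp (-t) * |x| := by
    calc |sg α t * y + ee α t * x - y| = |-((1 - sg α t) * y) + ee α t * x| := by congr 1; ring
      _ ≤ (1 - sg α t) * |y| + ee α t * |x| := by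
          refine (abs_add_le _ _).trans ?_
          rw [abs_neg, abs_mul, abs_mul, abs_of_nonneg e1, abs_of_pos (ee_pos _ _)]
      _ ≤ Real.exp (-t) / α * |y| + Real.exp (-t) * |x| := by
          gcongr
          exact ee_le h0 S.a1 ht
      _ = _ := by ring
  calc |h (sg α t * y + ee α t * x) - h y| ≤ C * |sg α t * y + ee α t * x - y| ^ β := H.leb _ _
    _ ≤ C * (Real.exp (-t) * (α⁻¹ * |y| + |x|)) ^ β := by
        have := H.nonneg
        gcongr
        linarith
    _ ≤ C * (Real.exp (-t) ^ β * ((α⁻¹ * |y|) ^ β + |x| ^ β)) := by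
        have := H.nonneg
        rw [Real.mul_rpow (by positivity) (by positivity)]
        gcongr
        exact Real.rpow_add_le_add_rpow (by positivity) (by positivity) b0.le S.b1.le
    _ = _ := by
        rw [← Real.exp_mul, Real.mul_rpow (by positivity) (by positivity), show -t * β = -β * t by ring]; ring

lemma Setup.ptw_int (S : Setup α β μ) (C t x : ℝ) :
    Integrable (fun y => C * Real.exp (-β * t) * (α⁻¹ ^ β * |y| ^ β + |x| ^ β)) μ :=
  ((S.mom.const_mul _).add (integrable_const _)).const_mul _

lemma Setup.G1 (S : Setup α β μ) {C : ℝ} {h : ℝ → ℝ} (H : memC β C h) {t : ℝ} (ht : 0 ≤ t) (x : ℝ) :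
    Integrable (fun y => h (sg α t * y + ee α t * x) - h y) μ := by
  refine (S.ptw_int C t x).mono' ?_ (Eventually.of_forall fun y => S.ptw H ht x y)
  have := H.cont
  exact (by fun_prop : Continuous fun y => h (sg α t * y + ee α t * x) - h y).aestronglyMeasurable

lemma Setup.G2 (S : Setup α β μ) {C : ℝ} {h : ℝ → ℝ} (H : memC β C h) {t : ℝ} (ht : 0 ≤ t) (x : ℝ) :
    |GG α μ h t x| ≤ C * Real.exp (-β * t) * ((α⁻¹ ^ β * ∫ y, |y| ^ β ∂μ) + |x| ^ β) := by
  have := norm_integral_le_of_norm_le (f := fun y => h (sg α t * y + ee α t * x) - h y) (S.ptw_int C t x) (Eventually.of_forall fun y => S.ptw H ht x y)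
  rw [integral_const_mul, integral_add (S.mom.const_mul _) (integrable_const _), integral_const_mul] at this
  simpa [GG] using this

lemma Setup.hInteg (S : Setup α β μ) {C : ℝ} {h : ℝ → ℝ} (H : memC β C h) : Integrable h μ := by
  have hc := H.cont
  have : Integrable (fun y => h y - h 0) μ := by
    refine (S.mom.const_mul C).mono' (by fun_prop : Continuous fun y => h y - h 0).aestronglyMeasurable
      (Eventually.of_forall fun y => ?_)
    simpa using H.leb y 0
  exact (this.add (integrable_const (h 0))).congr (Eventually.of_forall fun y => by simp)

lemma Setup.Gmeas (S : Setup α β μ) {C : ℝ} {h : ℝ → ℝ} (H : memC β C h) (x : ℝ) :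
    StronglyMeasurable (fun t => GG α μ h t x) := by
  unfold GG
  have hc := H.cont
  have h1 := sg_cont α S.a0
  have h2 := ee_cont α
  have : Continuous (fun p : ℝ × ℝ => h (sg α p.1 * p.2 + ee α p.1 * x) - h p.2) := by fun_prop
  exact this.stronglyMeasurable.integral_prod_right'

lemma expint {b : ℝ} (hb : 0 < b) : IntegrableOn (fun t => Real.exp (-b * t)) (Ioi 0) :=
  exp_neg_integrableOn_Ioi 0 hb

lemma expval {b : ℝ} (hb : 0 < b) : ∫ t in Ioi (0:ℝ), Real.exp (-b * t) = 1 / b := by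
  rw [integral_exp_mul_Ioi (by linarith)]; simp [neg_div_neg_eq]

lemma Setup.Gint (S : Setup α β μ) {C : ℝ} {h : ℝ → ℝ} (H : memC β C h) (x : ℝ) :
    IntegrableOn (fun t => GG α μ h t x) (Ioi 0) := by
  refine Integrable.mono' (((expint S.b0).const_mul C).mul_const ((α⁻¹ ^ β * ∫ y, |y| ^ β ∂μ) + |x| ^ β))
    (S.Gmeas H x).aestronglyMeasurable ?_
  filter_upwards [ae_restrict_mem measurableSet_Ioi] with t ht
  exact S.G2 H (le_of_lt ht) x

lemma Setup.G3 (S : Setup α β μ) {C : ℝ} {h : ℝ → ℝ} (H : memC β C h) {t : ℝ} (ht : 0 ≤ t) (x y : ℝ) :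
    |GG α μ h t x - GG α μ h t y| ≤ C * Real.exp (-β * t) * min |x - y| (|x - y| ^ β) := by
  unfold GG
  rw [← integral_sub (S.G1 H ht x) (S.G1 H ht y)]
  have key : ∀ z, ‖(h (sg α t * z + ee α t * x) - h z) - (h (sg α t * z + ee α t * y) - h z)‖ ≤
      C * Real.exp (-β * t) * min |x - y| (|x - y| ^ β) := by
    intro z
    have := H.nonneg
    rw [Real.norm_eq_abs, show (h (sg α t * z + ee α t * x) - h z) - (h (sg α t * z + ee α t * y) - h z)
      = h (sg α t * z + ee α t * x) - h (sg α t * z + ee α t * y) by ring]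
    refine (H _ _).trans ?_
    rw [show sg α t * z + ee α t * x - (sg α t * z + ee α t * y) = ee α t * (x - y) by ring, abs_mul,
      abs_of_pos (ee_pos _ _), Real.mul_rpow (ee_pos _ _).le (abs_nonneg _), mul_assoc,
      mul_min_of_nonneg _ _ (Real.exp_pos _).le]
    have h1 : ee α t ≤ Real.exp (-β * t) := by
      refine (ee_le S.a0 S.a1 ht).trans (Real.exp_le_exp.mpr ?_)
      nlinarith [S.b1, S.b0]
    have h2 := ee_rpow_le S.a0 S.a1 S.b0.le ht
    gcongr
  have := norm_integral_le_of_norm_le_const (μ := μ) (Eventually.of_forall key)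
  simpa using this

lemma Setup.F3 (S : Setup α β μ) {C : ℝ} {h : ℝ → ℝ} (H : memC β C h) : memC β (C / β) (FF α μ h) := by
  intro x y
  unfold FF
  rw [show ∀ a b : ℝ, -a - -b = -(a - b) by intros; ring, abs_neg, ← integral_sub (S.Gint H x) (S.Gint H y)]
  have := norm_integral_le_of_norm_le (μ := volume.restrict (Ioi (0:ℝ)))
    (f := fun t => GG α μ h t x - GG α μ h t y)
    (((expint S.b0).const_mul C).mul_const (min |x - y| (|x - y| ^ β))) (by
      filter_upwards [ae_restrict_mem measurableSet_Ioi] with t ht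
      exact S.G3 H (le_of_lt ht) x y)
  rw [integral_mul_const, integral_const_mul, expval S.b0] at this
  simpa [div_eq_mul_inv] using this

lemma Setup.G4 (S : Setup α β μ) {C : ℝ} {hn : ℕ → ℝ → ℝ} {h : ℝ → ℝ} (Hn : ∀ n, memC β C (hn n))
    (hl : ∀ x, Tendsto (fun n => hn n x) atTop (𝓝 (h x))) {t : ℝ} (ht : 0 ≤ t) (x : ℝ) :
    Tendsto (fun n => GG α μ (hn n) t x) atTop (𝓝 (GG α μ h t x)) := by
  unfold GG
  refine tendsto_integral_of_dominated_convergence _ (fun n => (S.G1 (Hn n) ht x).1) (S.ptw_int C t x)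
    (fun n => Eventually.of_forall fun y => S.ptw (Hn n) ht x y) (Eventually.of_forall fun y => ?_)
  exact (hl _).sub (hl _)

lemma memC.lim {C : ℝ} {hn : ℕ → ℝ → ℝ} {h : ℝ → ℝ} (Hn : ∀ n, memC β C (hn n))
    (hl : ∀ x, Tendsto (fun n => hn n x) atTop (𝓝 (h x))) : memC β C h := by
  intro x y
  exact le_of_tendsto ((hl x).sub (hl y)).abs (Eventually.of_forall fun n => Hn n x y)

lemma Setup.F4 (S : Setup α β μ) {C : ℝ} {hn : ℕ → ℝ → ℝ} {h : ℝ → ℝ} (Hn : ∀ n, memC β C (hn n))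
    (hl : ∀ x, Tendsto (fun n => hn n x) atTop (𝓝 (h x))) (x : ℝ) :
    Tendsto (fun n => FF α μ (hn n) x) atTop (𝓝 (FF α μ h x)) := by
  unfold FF
  refine Tendsto.neg ?_
  refine tendsto_integral_of_dominated_convergence _ (fun n => (S.Gint (Hn n) x).1)
    (((expint S.b0).const_mul C).mul_const ((α⁻¹ ^ β * ∫ y, |y| ^ β ∂μ) + |x| ^ β)) (fun n => ?_) ?_
  · filter_upwards [ae_restrict_mem measurableSet_Ioi] with t ht
    exact S.G2 (Hn n) (le_of_lt ht) x
  · filter_upwards [ae_restrict_mem measurableSet_Ioi] with t ht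
    exact S.G4 Hn hl (le_of_lt ht) x

lemma Setup.E4 (S : Setup α β μ) {C : ℝ} {hn : ℕ → ℝ → ℝ} {h : ℝ → ℝ} (Hn : ∀ n, memC β C (hn n))
    (hl : ∀ x, Tendsto (fun n => hn n x) atTop (𝓝 (h x))) :
    Tendsto (fun n => ∫ y, hn n y ∂μ) atTop (𝓝 (∫ y, h y ∂μ)) := by
  have key : Tendsto (fun n => ∫ y, (hn n y - hn n 0) ∂μ) atTop (𝓝 (∫ y, (h y - h 0) ∂μ)) := by
    refine tendsto_integral_of_dominated_convergence (fun y => C * |y| ^ β)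
      (fun n => ((S.hInteg (Hn n)).sub (integrable_const _)).1) (S.mom.const_mul C)
      (fun n => Eventually.of_forall fun y => by simpa using (Hn n).leb y 0)
      (Eventually.of_forall fun y => (hl _).sub (hl _))
  have hh := memC.lim Hn hl
  have := key.add (hl 0)
  rw [integral_sub (S.hInteg hh) (integrable_const _)] at this
  simp only [fun n => integral_sub (S.hInteg (Hn n)) (integrable_const (hn n 0))] at this
  simpa using this

lemma Setup.F5 (S : Setup α β μ) {C C' : ℝ} {h h' : ℝ → ℝ} (H : memC β C h) (H' : memC β C' h') (x : ℝ) :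
    FF α μ (fun x => h x + h' x) x = FF α μ h x + FF α μ h' x := by
  unfold FF
  rw [← neg_add, ← integral_add (S.Gint H x) (S.Gint H' x)]
  congr 1
  refine setIntegral_congr_fun measurableSet_Ioi fun t ht => ?_
  have ht : 0 ≤ t := le_of_lt ht
  unfold GG
  simp only
  rw [← integral_add (S.G1 H ht x) (S.G1 H' ht x)]
  congr 1; ext y; ring

lemma Setup.aediff (S : Setup α β μ) {C : ℝ} {h : ℝ → ℝ} (H : memC β C h) {t : ℝ} (ht : 0 < t) (x : ℝ) :
    ∀ᵐ y ∂μ, DifferentiableAt ℝ h (sg α t * y + ee α t * x) := by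
  apply S.ac.ae_le
  have h1 := H.lip.ae_differentiableAt_real
  have q1 : Measure.QuasiMeasurePreserving (fun y : ℝ => y + ee α t * x) volume volume :=
    (measurePreserving_add_right volume (ee α t * x)).quasiMeasurePreserving
  have q2 : Measure.QuasiMeasurePreserving (fun y : ℝ => sg α t * y) volume volume := by
    refine ⟨by fun_prop, ?_⟩
    rw [show (fun y : ℝ => sg α t * y) = (sg α t * ·) from rfl, Real.map_volume_mul_left (sg_pos ht).ne']
    exact Measure.smul_absolutelyContinuous
  exact (q1.comp q2).ae h1

lemma memC.deriv_le {C : ℝ} {h : ℝ → ℝ} (H : memC β C h) (x : ℝ) : |deriv h x| ≤ C := by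
  have := norm_deriv_le_of_lipschitz (x₀ := x) H.lip
  rwa [Real.coe_toNNReal _ H.nonneg] at this

lemma Setup.G6 (S : Setup α β μ) {C : ℝ} {h : ℝ → ℝ} (H : memC β C h) {t : ℝ} (ht : 0 < t) (x : ℝ) :
    HasDerivAt (GG α μ h t) (GD α μ h t x) x := by
  have hc := H.cont
  have := hasDerivAt_integral_of_dominated_loc_of_lip (μ := μ) (x₀ := x) (s := univ)
    (F := fun x y => h (sg α t * y + ee α t * x) - h y)
    (F' := fun y => ee α t * deriv h (sg α t * y + ee α t * x)) (bound := fun _ => C * ee α t) univ_mem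
    (Eventually.of_forall fun x => (S.G1 H ht.le x).1) (S.G1 H ht.le x)
    (by
      have := measurable_deriv h
      exact (by fun_prop : Measurable fun y => ee α t * deriv h (sg α t * y + ee α t * x)).aestronglyMeasurable)
    (Eventually.of_forall fun y => by
      refine LipschitzOnWith.of_dist_le_mul fun a _ b _ => ?_
      rw [Real.dist_eq, Real.dist_eq, Real.coe_nnabs, abs_of_nonneg (mul_nonneg H.nonneg (ee_pos _ _).le)]
      have := H.le1 (sg α t * y + ee α t * a) (sg α t * y + ee α t * b)
      rw [show sg α t * y + ee α t * a - (sg α t * y + ee α t * b) = ee α t * (a - b) by ring, abs_mul,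
        abs_of_pos (ee_pos _ _)] at this
      rw [show ∀ p q r : ℝ, p - q - (r - q) = p - r by intros; ring]
      linarith)
    (integrable_const _)
    (by
      filter_upwards [S.aediff H ht x] with y hy
      have h1 : HasDerivAt (fun x => sg α t * y + ee α t * x) (ee α t) x := by
        simpa using ((hasDerivAt_id x).const_mul (ee α t)).const_add (sg α t * y)
      have h2 := hy.hasDerivAt.comp x h1
      have h3 := h2.sub_const (h y)
      exact h3.congr_deriv (mul_comm _ _))
  have h2 := this.2
  rw [integral_const_mul] at h2
  exact h2

lemma Setup.GDle (S : Setup α β μ) {C : ℝ} {h : ℝ → ℝ} (H : memC β C h) (t x : ℝ) :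
    |GD α μ h t x| ≤ C * ee α t := by
  unfold GD
  rw [abs_mul, abs_of_pos (ee_pos _ _), mul_comm]
  refine mul_le_mul_of_nonneg_right ?_ (ee_pos _ _).le
  have := norm_integral_le_of_norm_le_const (μ := μ) (f := fun y => deriv h (sg α t * y + ee α t * x))
    (Eventually.of_forall fun y => H.deriv_le (sg α t * y + ee α t * x))
  simpa using this

lemma Setup.GDmeas (S : Setup α β μ) (h : ℝ → ℝ) (x : ℝ) :
    StronglyMeasurable (fun t => GD α μ h t x) := by
  unfold GD
  have hc := measurable_deriv h
  have h1 := (sg_cont α S.a0).measurable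
  have h2 := (ee_cont α).measurable
  have : Measurable (fun p : ℝ × ℝ => deriv h (sg α p.1 * p.2 + ee α p.1 * x)) := by fun_prop
  exact (ee_cont α).stronglyMeasurable.mul this.stronglyMeasurable.integral_prod_right'

lemma Setup.eeint (S : Setup α β μ) : IntegrableOn (ee α) (Ioi 0) := by
  have := expint (b := 1 / α) (by have := S.a0; positivity)
  refine IntegrableOn.congr_fun this (fun t _ => ?_) measurableSet_Ioi
  simp only [ee]; congr 1; ring

lemma Setup.GDint (S : Setup α β μ) {C : ℝ} {h : ℝ → ℝ} (H : memC β C h) (x : ℝ) :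
    IntegrableOn (fun t => GD α μ h t x) (Ioi 0) :=
  Integrable.mono' (S.eeint.const_mul C) (S.GDmeas h x).aestronglyMeasurable
    (Eventually.of_forall fun t => S.GDle H t x)

lemma Setup.G3' (S : Setup α β μ) {C : ℝ} {h : ℝ → ℝ} (H : memC β C h) {t : ℝ} (ht : 0 < t) (x y : ℝ) :
    |GG α μ h t x - GG α μ h t y| ≤ C * ee α t * |x - y| := by
  have := Convex.norm_image_sub_le_of_norm_hasDerivWithin_le (s := univ) (f := GG α μ h t)
    (f' := GD α μ h t) (C := C * ee α t) (fun z _ => (S.G6 H ht z).hasDerivWithinAt) (fun z _ => S.GDle H t z)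
    convex_univ (mem_univ y) (mem_univ x)
  simpa using this

lemma Setup.F6 (S : Setup α β μ) {C : ℝ} {h : ℝ → ℝ} (H : memC β C h) (x : ℝ) :
    HasDerivAt (FF α μ h) (-∫ t in Ioi (0:ℝ), GD α μ h t x) x := by
  unfold FF
  refine HasDerivAt.fun_neg ?_
  refine (hasDerivAt_integral_of_dominated_loc_of_lip (μ := volume.restrict (Ioi (0:ℝ))) (x₀ := x) (s := univ)
    (F := fun x t => GG α μ h t x)
    (F' := fun t => GD α μ h t x) (bound := fun t => C * ee α t) univ_mem
    (Eventually.of_forall fun x => (S.Gint H x).1) (S.Gint H x)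
    (S.GDmeas h x).aestronglyMeasurable ?_ (S.eeint.const_mul C) ?_).2
  · filter_upwards [ae_restrict_mem measurableSet_Ioi] with t ht
    refine LipschitzOnWith.of_dist_le_mul fun a _ b _ => ?_
    rw [Real.dist_eq, Real.dist_eq, Real.coe_nnabs, abs_of_nonneg (mul_nonneg H.nonneg (ee_pos _ _).le)]
    exact S.G3' H ht a b
  · filter_upwards [ae_restrict_mem measurableSet_Ioi] with t ht
    exact S.G6 H ht x

end

set_option linter.unusedSectionVars false
set_option linter.unusedVariables false

/-- increment -/
def DD (c : ℝ) (f : ℝ → ℝ) (x u : ℝ) : ℝ := (f (x + u) - f x) + c * (f (x - u) - f x)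
/-- (symmetrized) generator -/
def LL (c : ℝ) (N : ℝ → ℝ) (f : ℝ → ℝ) (x : ℝ) : ℝ := ∫ u, DD c f x u * N u

/-- domination of increments of Stein solutions -/
structure KB (α β : ℝ) (μ : Measure ℝ) (c : ℝ) (N K : ℝ → ℝ) : Prop where
  meas : Measurable N
  le : ∀ C h, memC β C h → ∀ x u, |DD c (FF α μ h) x u| ≤ C * K u
  int : Integrable (fun u => K u * |N u|)

/-- pointwise Stein equation -/
def PW (α : ℝ) (μ : Measure ℝ) (c : ℝ) (N : ℝ → ℝ) (h : ℝ → ℝ) : Prop :=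
  ∀ x, LL c N (FF α μ h) x - (1/α) * x * deriv (FF α μ h) x = h x - ∫ y, h y ∂μ

/-- integrated Stein equation -/
def INTG (α : ℝ) (μ : Measure ℝ) (c : ℝ) (N : ℝ → ℝ) (h : ℝ → ℝ) : Prop :=
  ∀ b, b * FF α μ h b - ∫ x in (0:ℝ)..b, FF α μ h x =
    α * ∫ x in (0:ℝ)..b, (LL c N (FF α μ h) x - (h x - ∫ y, h y ∂μ))

section
variable {α β : ℝ} {μ : Measure ℝ} [IsProbabilityMeasure μ]
  {c : ℝ} {N K : ℝ → ℝ}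

lemma Setup.F2 (S : Setup α β μ) {C : ℝ} {h : ℝ → ℝ} (H : memC β C h) (x : ℝ) :
    |FF α μ h x| ≤ C / β * ((α⁻¹ ^ β * ∫ y, |y| ^ β ∂μ) + |x| ^ β) := by
  unfold FF
  rw [abs_neg]
  have := norm_integral_le_of_norm_le (μ := volume.restrict (Ioi (0:ℝ)))
    (f := fun t => GG α μ h t x)
    (((expint S.b0).const_mul C).mul_const ((α⁻¹ ^ β * ∫ y, |y| ^ β ∂μ) + |x| ^ β)) (by
      filter_upwards [ae_restrict_mem measurableSet_Ioi] with t ht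
      exact S.G2 H (le_of_lt ht) x)
  rw [integral_mul_const, integral_const_mul, expval S.b0] at this
  simpa [div_eq_mul_inv] using this

lemma Setup.h2 (S : Setup α β μ) {C : ℝ} {h : ℝ → ℝ} (H : memC β C h) (x : ℝ) :
    |h x - ∫ y, h y ∂μ| ≤ C * ((α⁻¹ ^ β * ∫ y, |y| ^ β ∂μ) + |x| ^ β) := by
  have := S.G2 H le_rfl x
  have e : GG α μ h 0 x = h x - ∫ y, h y ∂μ := by
    have h0 := S.a0
    unfold GG sg ee
    simp only [neg_zero, Real.exp_zero, sub_self, zero_div, one_mul]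
    rw [Real.zero_rpow (by positivity)]
    simp only [zero_mul, zero_add]
    rw [integral_sub (integrable_const _) (S.hInteg H)]
    simp
  rw [e] at this
  simpa using this

lemma KB.dint (S : Setup α β μ) (B : KB α β μ c N K) {C : ℝ} {h : ℝ → ℝ} (H : memC β C h) (x : ℝ) :
    Integrable (fun u => DD c (FF α μ h) x u * N u) := by
  have hc := (S.F3 H).cont
  have hm := B.meas
  refine (B.int.const_mul C).mono' ?_ (Eventually.of_forall fun u => ?_)
  · have : Measurable fun u => DD c (FF α μ h) x u := by
      unfold DD
      exact (by fun_prop : Continuous _).measurable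
    exact (this.mul hm).aestronglyMeasurable
  · rw [norm_mul, Real.norm_eq_abs, Real.norm_eq_abs, ← mul_assoc]
    exact mul_le_mul_of_nonneg_right (B.le C h H x u) (abs_nonneg _)

lemma KB.bd (B : KB α β μ c N K) {C : ℝ} {h : ℝ → ℝ} (H : memC β C h) (x u : ℝ) :
    ‖DD c (FF α μ h) x u * N u‖ ≤ C * (K u * |N u|) := by
  rw [norm_mul, Real.norm_eq_abs, Real.norm_eq_abs, ← mul_assoc]
  exact mul_le_mul_of_nonneg_right (B.le C h H x u) (abs_nonneg _)

lemma KB.cont (S : Setup α β μ) (B : KB α β μ c N K) {C : ℝ} {h : ℝ → ℝ} (H : memC β C h) : Continuous (LL c N (FF α μ h)) := by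
  have hc := (S.F3 H).cont
  unfold LL
  refine continuous_of_dominated (bound := fun u => C * (K u * |N u|)) (fun x => (B.dint S H x).1)
    (fun x => Eventually.of_forall fun u => B.bd H x u) (B.int.const_mul C) (Eventually.of_forall fun u => ?_)
  unfold DD
  fun_prop

lemma KB.Lbd (B : KB α β μ c N K) {C : ℝ} {h : ℝ → ℝ} (H : memC β C h) (x : ℝ) :
    |LL c N (FF α μ h) x| ≤ C * ∫ u, K u * |N u| := by
  have := norm_integral_le_of_norm_le (B.int.const_mul C) (Eventually.of_forall fun u => B.bd H x u)
  rwa [integral_const_mul] at this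

lemma KB.lim (S : Setup α β μ) (B : KB α β μ c N K) {C : ℝ} {hn : ℕ → ℝ → ℝ} {h : ℝ → ℝ} (Hn : ∀ n, memC β C (hn n))
    (hl : ∀ x, Tendsto (fun n => hn n x) atTop (𝓝 (h x))) (x : ℝ) :
    Tendsto (fun n => LL c N (FF α μ (hn n)) x) atTop (𝓝 (LL c N (FF α μ h) x)) := by
  unfold LL
  refine tendsto_integral_of_dominated_convergence (fun u => C * (K u * |N u|)) (fun n => (B.dint S (Hn n) x).1)
    (B.int.const_mul C) (fun n => Eventually.of_forall fun u => B.bd (Hn n) x u)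
    (Eventually.of_forall fun u => ?_)
  unfold DD
  have := S.F4 Hn hl
  exact (((this _).sub (this _)).add (((this _).sub (this _)).const_mul c)).mul_const _

lemma PW.toINT (S : Setup α β μ) (B : KB α β μ c N K) {C : ℝ} {h : ℝ → ℝ} (H : memC β C h) (hp : PW α μ c N h) : INTG α μ c N h := by
  intro b
  have hc := (S.F3 H).cont
  have hLc := B.cont S H
  have hhc := H.cont
  have h0 := S.a0
  have key : ∀ x, HasDerivAt (fun x => x * FF α μ h x)
      (FF α μ h x + α * (LL c N (FF α μ h) x - (h x - ∫ y, h y ∂μ))) x := by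
    intro x
    have h1 := S.F6 H x
    have h2 := (hasDerivAt_id x).mul h1
    refine h2.congr_deriv ?_
    rw [← hp x, h1.deriv]
    simp
    field_simp
  have := intervalIntegral.integral_eq_sub_of_hasDerivAt (a := 0) (b := b) (fun x _ => key x)
    ((by fun_prop : Continuous fun x => FF α μ h x + α * (LL c N (FF α μ h) x - (h x - ∫ y, h y ∂μ))).intervalIntegrable _ _)
  rw [intervalIntegral.integral_add (hc.intervalIntegrable _ _)
    ((by fun_prop : Continuous fun x => α * (LL c N (FF α μ h) x - (h x - ∫ y, h y ∂μ))).intervalIntegrable _ _),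
    intervalIntegral.integral_const_mul] at this
  linarith

lemma INTG.toPW (S : Setup α β μ) (B : KB α β μ c N K) {C : ℝ} {h : ℝ → ℝ} (H : memC β C h) (hp : INTG α μ c N h) : PW α μ c N h := by
  intro x
  have hc := (S.F3 H).cont
  have hLc := B.cont S H
  have hhc := H.cont
  have h0 := S.a0
  have h1 := S.F6 H x
  have d1 : HasDerivAt (fun b => b * FF α μ h b - ∫ x in (0:ℝ)..b, FF α μ h x)
      (FF α μ h x + x * deriv (FF α μ h) x - FF α μ h x) x := by
    have := ((hasDerivAt_id x).mul h1).sub (hc.integral_hasStrictDerivAt 0 x).hasDerivAt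
    refine this.congr_deriv ?_
    rw [h1.deriv]; simp
  have d2 : HasDerivAt (fun b => α * ∫ x in (0:ℝ)..b, (LL c N (FF α μ h) x - (h x - ∫ y, h y ∂μ)))
      (α * (LL c N (FF α μ h) x - (h x - ∫ y, h y ∂μ))) x :=
    ((by fun_prop : Continuous fun x => (LL c N (FF α μ h) x - (h x - ∫ y, h y ∂μ))).integral_hasStrictDerivAt 0 x).hasDerivAt.const_mul α
  rw [show (fun b => b * FF α μ h b - ∫ x in (0:ℝ)..b, FF α μ h x) = _ from funext hp] at d1
  have := d1.unique d2
  have e : x * deriv (FF α μ h) x = α * (LL c N (FF α μ h) x - (h x - ∫ y, h y ∂μ)) := by linarith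
  rw [mul_assoc, e]
  field_simp
  ring

lemma INTG.lim (S : Setup α β μ) (B : KB α β μ c N K) {C : ℝ} {hn : ℕ → ℝ → ℝ} {h : ℝ → ℝ} (Hn : ∀ n, memC β C (hn n))
    (hl : ∀ x, Tendsto (fun n => hn n x) atTop (𝓝 (h x))) (hi : ∀ n, INTG α μ c N (hn n)) :
    INTG α μ c N h := by
  intro b
  set M := α⁻¹ ^ β * ∫ y, |y| ^ β ∂μ with hM
  have hF := S.F4 Hn hl
  have b0 := S.b0
  have hpc : Continuous fun x : ℝ => M + |x| ^ β := by
    refine continuous_const.add (continuous_abs.rpow_const fun _ => Or.inr b0.le)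
  have l1 : Tendsto (fun n => ∫ x in (0:ℝ)..b, FF α μ (hn n) x) atTop (𝓝 (∫ x in (0:ℝ)..b, FF α μ h x)) := by
    refine intervalIntegral.tendsto_integral_filter_of_dominated_convergence
      (fun x => C / β * (M + |x| ^ β)) (Eventually.of_forall fun n => (S.F3 (Hn n)).cont.aestronglyMeasurable)
      (Eventually.of_forall fun n => Eventually.of_forall fun x _ => S.F2 (Hn n) x)
      ((hpc.const_mul (C / β)).intervalIntegrable _ _)
      (Eventually.of_forall fun x _ => hF x)
  have l2 : Tendsto (fun n => ∫ x in (0:ℝ)..b, (LL c N (FF α μ (hn n)) x - (hn n x - ∫ y, hn n y ∂μ))) atTop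
      (𝓝 (∫ x in (0:ℝ)..b, (LL c N (FF α μ h) x - (h x - ∫ y, h y ∂μ)))) := by
    refine intervalIntegral.tendsto_integral_filter_of_dominated_convergence
      (fun x => (C * ∫ u, K u * |N u|) + C * (M + |x| ^ β)) (Eventually.of_forall fun n => ?_)
      (Eventually.of_forall fun n => Eventually.of_forall fun x _ => ?_)
      ((continuous_const.add (hpc.const_mul C)).intervalIntegrable _ _)
      (Eventually.of_forall fun x _ => ?_)
    · have h1 := B.cont S (Hn n)
      have h2 := (Hn n).cont
      exact (by fun_prop : Continuous fun x => LL c N (FF α μ (hn n)) x - (hn n x - ∫ y, hn n y ∂μ)).aestronglyMeasurable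
    · refine (norm_sub_le _ _).trans (add_le_add (B.Lbd (Hn n) x) (S.h2 (Hn n) x))
    · exact (B.lim S Hn hl x).sub ((hl x).sub (S.E4 Hn hl))
  refine tendsto_nhds_unique ((((hF b).const_mul b).sub l1).congr fun n => hi n b) (l2.const_mul α)

lemma PW.add (S : Setup α β μ) (B : KB α β μ c N K) {C C' : ℝ} {h h' : ℝ → ℝ} (H : memC β C h) (H' : memC β C' h') (hp : PW α μ c N h) (hp' : PW α μ c N h') :
    PW α μ c N (fun x => h x + h' x) := by
  intro x
  have e : FF α μ (fun x => h x + h' x) = fun x => FF α μ h x + FF α μ h' x := funext fun x => S.F5 H H' x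
  have e2 : LL c N (fun x => FF α μ h x + FF α μ h' x) x = LL c N (FF α μ h) x + LL c N (FF α μ h') x := by
    unfold LL
    rw [← integral_add (B.dint S H x) (B.dint S H' x)]
    congr 1; ext u; unfold DD; ring
  have e3 : deriv (fun x => FF α μ h x + FF α μ h' x) x = deriv (FF α μ h) x + deriv (FF α μ h') x :=
    deriv_fun_add (S.F6 H x).differentiableAt (S.F6 H' x).differentiableAt
  rw [e, e2, e3, integral_add (S.hInteg H) (S.hInteg H')]
  linarith [hp x, hp' x]

lemma PW.zero : PW α μ c N (fun _ => 0) := by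
  intro x
  have : FF α μ (fun _ => 0) = fun _ => 0 := by ext; simp [FF, GG]
  rw [this]; simp [LL, DD]

lemma memC.zero : memC β 0 (fun _ => 0) := by intro x y; simp

lemma PW.sum (S : Setup α β μ) (B : KB α β μ c N K) {h : ℕ → ℝ → ℝ} (H : ∀ k, ∃ C, memC β C (h k)) (hp : ∀ k, PW α μ c N (h k)) (n : ℕ) :
    (∃ C, memC β C (fun x => ∑ k ∈ Finset.range n, h k x)) ∧
    PW α μ c N (fun x => ∑ k ∈ Finset.range n, h k x) := by
  induction n with
  | zero => simp only [Finset.range_zero, Finset.sum_empty]; exact ⟨⟨0, memC.zero⟩, PW.zero⟩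
  | succ n ih =>
    simp only [Finset.sum_range_succ]
    obtain ⟨⟨C, hC⟩, h1⟩ := ih
    obtain ⟨C', hC'⟩ := H n
    exact ⟨⟨C + C', hC.add hC'⟩, h1.add S B hC hC' (hp n)⟩

end

set_option linter.unusedSectionVars false
set_option linter.unusedVariables false

/-- semigroup applied to an exponential -/
def EE (α : ℝ) (P : ℂ) (l t x : ℝ) : ℂ :=
  Complex.exp (-((1 - Real.exp (-t) : ℝ) : ℂ) * P + ((l * ee α t * x : ℝ) : ℂ) * Complex.I)

lemma EE_cont (α : ℝ) (P : ℂ) (l : ℝ) : Continuous fun q : ℝ × ℝ => EE α P l q.1 q.2 := by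
  unfold EE
  have := ee_cont α
  fun_prop

lemma EE_norm {α : ℝ} {P : ℂ} (hP : 0 ≤ P.re) (l : ℝ) {t : ℝ} (ht : 0 ≤ t) (x : ℝ) : ‖EE α P l t x‖ ≤ 1 := by
  unfold EE
  rw [Complex.norm_exp, Real.exp_le_one_iff]
  have : Real.exp (-t) ≤ 1 := by rw [Real.exp_le_one_iff]; linarith
  rw [Complex.add_re, ← Complex.ofReal_neg, Complex.re_ofReal_mul, Complex.re_ofReal_mul]
  simp
  nlinarith

lemma EE_sub_norm {α : ℝ} (h0 : 0 < α) (h1 : α ≤ 1) {P : ℂ} (hP : 0 ≤ P.re) (l : ℝ) {t : ℝ} (ht : 0 ≤ t) (x : ℝ) :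
    ‖EE α P l t x - Complex.exp (-P)‖ ≤ (‖P‖ + |l * x|) * Real.exp (-t) := by
  have h3 := (ee_pos α t).le
  have h4 := ee_le h0 h1 ht
  have e : ‖EE α P l t x - Complex.exp (-P)‖ = ‖EE α P l t x‖ *
      ‖Complex.exp (-(Real.exp (-t) * P + ((l * ee α t * x : ℝ) : ℂ) * Complex.I)) - 1‖ := by
    rw [← norm_mul, mul_sub, mul_one, ← norm_neg, neg_sub]
    congr 2
    unfold EE
    rw [← Complex.exp_add]
    congr 1
    push_cast
    ring
  rw [e]
  have e1 : (0:ℝ) ≤ (Real.exp (-t) * P + ((l * ee α t * x : ℝ) : ℂ) * Complex.I).re := by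
    rw [Complex.add_re, Complex.re_ofReal_mul, Complex.re_ofReal_mul]
    simp
    positivity
  calc _ ≤ 1 * ‖(Real.exp (-t) * P + ((l * ee α t * x : ℝ) : ℂ) * Complex.I)‖ := by
        gcongr
        · exact EE_norm hP l ht x
        · exact norm_exp_neg_sub_one_le e1
    _ ≤ Real.exp (-t) * ‖P‖ + |l * x| * ee α t := by
        rw [one_mul]
        refine (norm_add_le _ _).trans ?_
        rw [norm_mul, norm_mul, Complex.norm_I, mul_one, Complex.norm_real, Complex.norm_real, Real.norm_eq_abs,
          Real.norm_eq_abs, abs_of_pos (Real.exp_pos _), show l * ee α t * x = l * x * ee α t by ring, abs_mul,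
          abs_of_nonneg h3]
    _ ≤ _ := by nlinarith [abs_nonneg (l * x)]

lemma EE_int {α : ℝ} (h0 : 0 < α) (h1 : α ≤ 1) {P : ℂ} (hP : 0 ≤ P.re) (l x : ℝ) :
    IntegrableOn (fun t => EE α P l t x - Complex.exp (-P)) (Ioi 0) := by
  have hi := (expint zero_lt_one).const_mul (‖P‖ + |l * x|)
  refine Integrable.mono' hi ?_ ?_
  · have := EE_cont α P l
    exact (by fun_prop : Continuous fun t => EE α P l t x - Complex.exp (-P)).aestronglyMeasurable
  · filter_upwards [ae_restrict_mem measurableSet_Ioi] with t ht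
    simpa using EE_sub_norm h0 h1 hP l (le_of_lt ht) x

/-- complex Stein solution for exponentials -/
def FC (α : ℝ) (P : ℂ) (l x : ℝ) : ℂ := -∫ t in Ioi (0:ℝ), (EE α P l t x - Complex.exp (-P))

lemma eeint' {α : ℝ} (h0 : 0 < α) : IntegrableOn (ee α) (Ioi 0) := by
  have := expint (b := 1 / α) (by positivity)
  refine IntegrableOn.congr_fun this (fun t _ => ?_) measurableSet_Ioi
  simp only [ee]; congr 1; ring

lemma EE_dx (α : ℝ) (P : ℂ) (l t x : ℝ) :
    HasDerivAt (fun x => EE α P l t x) (EE α P l t x * (((l * ee α t : ℝ) : ℂ) * Complex.I)) x := by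
  unfold EE
  refine HasDerivAt.cexp ?_
  have h1 : HasDerivAt (fun x : ℝ => l * ee α t * x) (l * ee α t) x := by
    simpa using (hasDerivAt_id x).const_mul (l * ee α t)
  exact (h1.ofReal_comp.mul_const Complex.I).const_add _

lemma EE_dt {α : ℝ} (P : ℂ) (l t x : ℝ) :
    HasDerivAt (fun t => EE α P l t x)
      (EE α P l t x * (-(Real.exp (-t) : ℂ) * P - ((l * ee α t * x / α : ℝ) : ℂ) * Complex.I)) t := by
  unfold EE
  refine HasDerivAt.cexp ?_
  have h1 : HasDerivAt (fun t : ℝ => 1 - Real.exp (-t)) (Real.exp (-t)) t := by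
    have := ((hasDerivAt_id t).neg.exp).const_sub 1
    simpa using this
  have h2 : HasDerivAt (fun t : ℝ => l * ee α t * x) (-(l * ee α t * x / α)) t := by
    have : HasDerivAt (ee α) (ee α t * (-1 / α)) t := by
      have := ((hasDerivAt_id t).neg.div_const α).exp
      show HasDerivAt (fun t => Real.exp (-t/α)) (Real.exp (-t/α) * (-1/α)) t
      simpa using this
    have := (this.const_mul l).mul_const x
    refine this.congr_deriv ?_
    ring
  have := (h1.ofReal_comp.neg.mul_const P).add (h2.ofReal_comp.mul_const Complex.I)
  refine this.congr_deriv ?_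
  push_cast; ring

lemma EE_dint {α : ℝ} (h0 : 0 < α) {P : ℂ} (hP : 0 ≤ P.re) (l x : ℝ) :
    IntegrableOn (fun t => EE α P l t x * (((l * ee α t : ℝ) : ℂ) * Complex.I)) (Ioi 0) := by
  refine Integrable.mono' ((eeint' h0).const_mul |l|) ?_ ?_
  · have := EE_cont α P l
    have := ee_cont α
    exact (by fun_prop : Continuous fun t => EE α P l t x * (((l * ee α t : ℝ) : ℂ) * Complex.I)).aestronglyMeasurable
  · filter_upwards [ae_restrict_mem measurableSet_Ioi] with t ht
    rw [norm_mul, norm_mul, Complex.norm_I, mul_one, Complex.norm_real, Real.norm_eq_abs, abs_mul, abs_of_pos (ee_pos _ _)]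
    have := EE_norm (α := α) hP l (le_of_lt ht) x
    have := ee_pos α t
    refine (mul_le_mul_of_nonneg_right ‹‖_‖ ≤ 1› (by positivity)).trans (by rw [one_mul])

lemma FC_dx {α : ℝ} (h0 : 0 < α) (h1 : α ≤ 1) {P : ℂ} (hP : 0 ≤ P.re) (l x : ℝ) :
    HasDerivAt (FC α P l) (-∫ t in Ioi (0:ℝ), EE α P l t x * (((l * ee α t : ℝ) : ℂ) * Complex.I)) x := by
  unfold FC
  refine HasDerivAt.fun_neg ?_
  refine (hasDerivAt_integral_of_dominated_loc_of_deriv_le (μ := volume.restrict (Ioi (0:ℝ))) (x₀ := x) (s := univ)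
    (F := fun x t => EE α P l t x - Complex.exp (-P))
    (F' := fun x t => EE α P l t x * (((l * ee α t : ℝ) : ℂ) * Complex.I)) (bound := fun t => |l| * ee α t) univ_mem
    (Eventually.of_forall fun x => (EE_int h0 h1 hP l x).1) (EE_int h0 h1 hP l x)
    (EE_dint h0 hP l x).1 ?_ ((eeint' h0).const_mul |l|) ?_).2
  · filter_upwards [ae_restrict_mem measurableSet_Ioi] with t ht y _
    rw [norm_mul, norm_mul, Complex.norm_I, mul_one, Complex.norm_real, Real.norm_eq_abs, abs_mul, abs_of_pos (ee_pos _ _)]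
    have := EE_norm (α := α) hP l (le_of_lt ht) y
    have := ee_pos α t
    refine (mul_le_mul_of_nonneg_right ‹‖_‖ ≤ 1› (by positivity)).trans (by rw [one_mul])
  · refine Eventually.of_forall fun t y _ => (EE_dx α P l t y).sub_const _

lemma EE_q (α : ℝ) (P : ℂ) (l t x u c : ℝ) :
    EE α P l t x * qf c (ee α t * l) u =
    ((EE α P l t (x + u) - Complex.exp (-P)) - (EE α P l t x - Complex.exp (-P)))
      + c * ((EE α P l t (x - u) - Complex.exp (-P)) - (EE α P l t x - Complex.exp (-P))) := by
  have e1 : EE α P l t (x + u) = EE α P l t x * Complex.exp (((ee α t * l : ℝ) : ℂ) * u * Complex.I) := by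
    unfold EE; rw [← Complex.exp_add]; congr 1; push_cast; ring
  have e2 : EE α P l t (x - u) = EE α P l t x * Complex.exp (-(((ee α t * l : ℝ) : ℂ) * u * Complex.I)) := by
    unfold EE; rw [← Complex.exp_add]; congr 1; push_cast; ring
  rw [e1, e2, qf]
  ring

lemma FC_q {α : ℝ} (h0 : 0 < α) (h1 : α ≤ 1) {P : ℂ} (hP : 0 ≤ P.re) (l x u c : ℝ) :
    (FC α P l (x + u) - FC α P l x) + c * (FC α P l (x - u) - FC α P l x) =
    -∫ t in Ioi (0:ℝ), EE α P l t x * qf c (ee α t * l) u := by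
  simp_rw [EE_q]
  have i := EE_int h0 h1 hP l
  have i2 : ∀ a b, IntegrableOn (fun t => (EE α P l t a - Complex.exp (-P)) - (EE α P l t b - Complex.exp (-P))) (Ioi 0) :=
    fun a b => (i a).sub (i b)
  rw [integral_add (i2 _ _) ((i2 _ _).const_mul _), integral_const_mul, integral_sub (i _) (i _),
    integral_sub (i _) (i _)]
  unfold FC
  ring

lemma qf_scale (c r l u : ℝ) : qf c (r * l) u = qf c l (r * u) := by
  unfold qf; push_cast
  rw [show (r:ℂ) * l * u * Complex.I = l * (r * u) * Complex.I by ring]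

lemma ee_rpow {α : ℝ} (h0 : 0 < α) (t : ℝ) : ee α t ^ α = Real.exp (-t) := by
  unfold ee; rw [← Real.exp_mul]; congr 1; field_simp

lemma qf_cont (c : ℝ) : Continuous fun q : ℝ × ℝ => qf c q.1 q.2 := by
  unfold qf; fun_prop

lemma prod_int {α δ c : ℝ} {N : ℝ → ℝ} (h0 : 0 < α) (D : LevyData α (psi α δ) c N)
    {P : ℂ} (hP : 0 ≤ P.re) (l x : ℝ) :
    Integrable (fun q : ℝ × ℝ => EE α P l q.1 x * qf c (ee α q.1 * l) q.2 * (N q.2 : ℂ))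
      ((volume.restrict (Ioi (0:ℝ))).prod volume) := by
  have hm : AEStronglyMeasurable (fun q : ℝ × ℝ => EE α P l q.1 x * qf c (ee α q.1 * l) q.2 * (N q.2 : ℂ))
      ((volume.restrict (Ioi (0:ℝ))).prod volume) := by
    have a1 := EE_cont α P l
    have a2 := qf_cont c
    have a3 := ee_cont α
    have c1 : Continuous (fun q : ℝ × ℝ => EE α P l q.1 x * qf c (ee α q.1 * l) q.2) := by
      refine Continuous.mul ?_ ?_
      · exact a1.comp (by fun_prop : Continuous fun q : ℝ × ℝ => (q.1, x))
      · exact a2.comp (by fun_prop : Continuous fun q : ℝ × ℝ => (ee α q.1 * l, q.2))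
    have c2 : Measurable (fun q : ℝ × ℝ => (N q.2 : ℂ)) := by
      have := D.meas
      fun_prop
    exact (c1.measurable.mul c2).aestronglyMeasurable
  rw [integrable_prod_iff hm]
  constructor
  · refine Eventually.of_forall fun t => ?_
    have := (D.qint (ee α t * l)).const_mul (EE α P l t x)
    exact this.congr (Eventually.of_forall fun u => (mul_assoc _ _ _).symm)
  · set A := ∫ u, ‖qf c l u * (N u : ℂ)‖ with hA
    refine Integrable.mono' ((expint zero_lt_one).mul_const A) hm.norm.integral_prod_right' ?_
    filter_upwards [ae_restrict_mem measurableSet_Ioi] with t ht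
    have er := ee_pos α t
    have e : ∀ u, ‖EE α P l t x * qf c (ee α t * l) u * (N u : ℂ)‖ =
        ‖EE α P l t x‖ * ee α t ^ (1 + α) * ‖qf c l (ee α t * u) * (N (ee α t * u) : ℂ)‖ := by
      intro u
      rw [D.hom _ er, qf_scale]
      push_cast
      rw [norm_mul, norm_mul, norm_mul, norm_mul, Complex.norm_real (ee α t ^ (-1 - α)), Real.norm_of_nonneg (by positivity : 0 ≤ ee α t ^ (-1 - α)),
        show -1 - α = -(1 + α) by ring, Real.rpow_neg er.le]
      field_simp
    simp only [e]
    rw [integral_const_mul, Measure.integral_comp_mul_left (fun u => ‖qf c l u * (N u : ℂ)‖), ← hA, abs_inv, abs_of_pos er,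
      smul_eq_mul, Real.rpow_add er, Real.rpow_one, ee_rpow h0]
    have hA0 : 0 ≤ A := integral_nonneg fun _ => norm_nonneg _
    have h1 := EE_norm (α := α) hP l (le_of_lt ht) x
    rw [show ‖EE α P l t x‖ * (ee α t * Real.exp (-t)) * ((ee α t)⁻¹ * A) = ‖EE α P l t x‖ * (Real.exp (-t) * A) by
      field_simp, Real.norm_of_nonneg (by positivity), show -1 * t = -t by ring]
    exact mul_le_of_le_one_left (by positivity) h1

lemma FC_gen {α δ c : ℝ} {N : ℝ → ℝ} (h0 : 0 < α) (h1 : α ≤ 1) (D : LevyData α (psi α δ) c N) (l x : ℝ) :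
    Integrable (fun u => ((FC α (psi α δ l) l (x + u) - FC α (psi α δ l) l x)
      + c * (FC α (psi α δ l) l (x - u) - FC α (psi α δ l) l x)) * (N u : ℂ)) ∧
    ∫ u, ((FC α (psi α δ l) l (x + u) - FC α (psi α δ l) l x)
      + c * (FC α (psi α δ l) l (x - u) - FC α (psi α δ l) l x)) * (N u : ℂ) =
    ∫ t in Ioi (0:ℝ), EE α (psi α δ l) l t x * ((Real.exp (-t) : ℂ) * psi α δ l) := by
  set P := psi α δ l with hPd
  have hP : 0 ≤ P.re := psi_re_nonneg _ _ _
  have hi := prod_int h0 D hP l x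
  have e : ∀ u, ((FC α P l (x + u) - FC α P l x) + c * (FC α P l (x - u) - FC α P l x)) * (N u : ℂ)
      = -∫ t in Ioi (0:ℝ), EE α P l t x * qf c (ee α t * l) u * (N u : ℂ) := by
    intro u
    rw [FC_q h0 h1 hP, integral_mul_const, neg_mul]
  simp_rw [e]
  refine ⟨hi.integral_prod_right.neg, ?_⟩
  rw [integral_neg, ← integral_integral_swap hi, ← integral_neg]
  refine setIntegral_congr_fun measurableSet_Ioi fun t _ => ?_
  simp only [mul_assoc]
  rw [integral_const_mul, D.qval, psi_smul h0 _ (ee_pos _ _).le, ee_rpow h0]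
  simp only [← hPd]
  ring

lemma EE_expint {α : ℝ} {P : ℂ} (hP : 0 ≤ P.re) (l x : ℝ) :
    IntegrableOn (fun t => EE α P l t x * ((Real.exp (-t) : ℂ) * P)) (Ioi 0) := by
  refine Integrable.mono' ((expint zero_lt_one).mul_const ‖P‖) ?_ ?_
  · have := EE_cont α P l
    exact (by fun_prop : Continuous fun t => EE α P l t x * ((Real.exp (-t) : ℂ) * P)).aestronglyMeasurable
  · filter_upwards [ae_restrict_mem measurableSet_Ioi] with t ht
    rw [norm_mul, norm_mul, Complex.norm_real, Real.norm_of_nonneg (Real.exp_pos _).le, show -1 * t = -t by ring]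
    exact mul_le_of_le_one_left (by positivity) (EE_norm hP l (le_of_lt ht) x)

lemma FC_eq {α δ c : ℝ} {N : ℝ → ℝ} (h0 : 0 < α) (h1 : α ≤ 1) (D : LevyData α (psi α δ) c N) (l x : ℝ) :
    (∫ u, ((FC α (psi α δ l) l (x + u) - FC α (psi α δ l) l x)
      + c * (FC α (psi α δ l) l (x - u) - FC α (psi α δ l) l x)) * (N u : ℂ)) -
      ((1 / α * x : ℝ) : ℂ) * deriv (FC α (psi α δ l) l) x =
    Complex.exp (((l * x : ℝ) : ℂ) * Complex.I) - Complex.exp (-psi α δ l) := by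
  rw [(FC_gen h0 h1 D l x).2]
  set P := psi α δ l with hPd
  have hP : 0 ≤ P.re := psi_re_nonneg _ _ _
  rw [(FC_dx h0 h1 hP l x).deriv, mul_neg, sub_neg_eq_add, ← integral_const_mul,
    ← integral_add (EE_expint hP l x) ((EE_dint h0 hP l x).const_mul _)]
  have hd : ∀ t ∈ Ici (0:ℝ), HasDerivAt (fun t => -(EE α P l t x)) (EE α P l t x * ((Real.exp (-t) : ℂ) * P) +
      ((1 / α * x : ℝ) : ℂ) * (EE α P l t x * (((l * ee α t : ℝ) : ℂ) * Complex.I))) t := by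
    intro t _
    refine (EE_dt P l t x).fun_neg.congr_deriv ?_
    push_cast; ring
  have hlim : Tendsto (fun t => -(EE α P l t x)) atTop (𝓝 (-Complex.exp (-P))) := by
    refine Tendsto.neg ?_
    rw [tendsto_iff_norm_sub_tendsto_zero]
    have : Tendsto (fun t : ℝ => (‖P‖ + |l * x|) * Real.exp (-t)) atTop (𝓝 0) := by
      simpa using (Real.tendsto_exp_neg_atTop_nhds_zero).const_mul (‖P‖ + |l * x|)
    refine squeeze_zero' (Eventually.of_forall fun _ => norm_nonneg _) ?_ this
    filter_upwards [eventually_ge_atTop 0] with t ht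
    exact EE_sub_norm h0 h1 hP l ht x
  rw [integral_Ioi_of_hasDerivAt_of_tendsto' hd ((EE_expint hP l x).add ((EE_dint h0 hP l x).const_mul _)) hlim]
  have : EE α P l 0 x = Complex.exp (((l * x : ℝ) : ℂ) * Complex.I) := by
    unfold EE ee; simp
  rw [this]; ring

lemma memC_exp {β : ℝ} (hb : 0 < β) (hb1 : β < 1) (z : ℂ) (l : ℝ) :
    memC β (‖z‖ * (|l| + 2)) (fun x => (z * Complex.exp (((l * x : ℝ) : ℂ) * Complex.I)).re) := by
  intro x y
  have e1 : |(z * Complex.exp (((l * x : ℝ) : ℂ) * Complex.I)).re - (z * Complex.exp (((l * y : ℝ) : ℂ) * Complex.I)).re|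
      ≤ ‖z‖ * ‖Complex.exp (((l * x : ℝ) : ℂ) * Complex.I) - Complex.exp (((l * y : ℝ) : ℂ) * Complex.I)‖ := by
    rw [← Complex.sub_re, ← mul_sub, ← norm_mul]
    exact Complex.abs_re_le_norm _
  have e2 : ‖Complex.exp (((l * x : ℝ) : ℂ) * Complex.I) - Complex.exp (((l * y : ℝ) : ℂ) * Complex.I)‖ ≤ 2 := by
    refine (norm_sub_le _ _).trans ?_
    rw [Complex.norm_exp_ofReal_mul_I, Complex.norm_exp_ofReal_mul_I]; norm_num
  have e3 : ‖Complex.exp (((l * x : ℝ) : ℂ) * Complex.I) - Complex.exp (((l * y : ℝ) : ℂ) * Complex.I)‖ ≤ |l| * |x - y| := by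
    have : Complex.exp (((l * x : ℝ) : ℂ) * Complex.I) - Complex.exp (((l * y : ℝ) : ℂ) * Complex.I)
      = Complex.exp (((l * y : ℝ) : ℂ) * Complex.I) * (Complex.exp (-(((-(l * (x - y)) : ℝ) : ℂ) * Complex.I)) - 1) := by
      rw [mul_sub, ← Complex.exp_add, mul_one]; congr 2; push_cast; ring
    rw [this, norm_mul, Complex.norm_exp_ofReal_mul_I, one_mul]
    refine (norm_exp_neg_sub_one_le ?_).trans ?_
    · rw [Complex.re_ofReal_mul]; simp
    · rw [norm_mul, Complex.norm_I, mul_one, Complex.norm_real, Real.norm_eq_abs, abs_neg, abs_mul]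
  refine e1.trans ?_
  rw [mul_assoc]
  refine mul_le_mul_of_nonneg_left ?_ (norm_nonneg _)
  have hl := abs_nonneg l
  rcases le_total |x - y| 1 with h | h
  · have : |x - y| ≤ |x - y| ^ β := by
      rcases (abs_nonneg (x - y)).eq_or_lt with h' | h'
      · rw [← h', Real.zero_rpow hb.ne']
      · simpa using Real.rpow_le_rpow_of_exponent_ge h' h hb1.le
    rw [min_eq_left this]
    nlinarith [abs_nonneg (x - y)]
  · have : 1 ≤ min |x - y| (|x - y| ^ β) := le_min h (Real.one_le_rpow h hb.le)
    nlinarith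

lemma int_re {X : Type*} [MeasurableSpace X] {μ : Measure X} {f : X → ℂ} (hf : Integrable f μ) :
    ∫ x, (f x).re ∂μ = (∫ x, f x ∂μ).re := integral_re hf

lemma PW_exp {α β δ c : ℝ} {N : ℝ → ℝ} {μ : Measure ℝ} [IsProbabilityMeasure μ] (S : Setup α β μ)
    (D : LevyData α (psi α δ) c N)
    (hZ : ∀ l : ℝ, ∫ x : ℝ, Complex.exp (((l * x : ℝ) : ℂ) * Complex.I) ∂μ = Complex.exp (-psi α δ l)) (z : ℂ) (l : ℝ) :
    PW α μ c N (fun x => (z * Complex.exp (((l * x : ℝ) : ℂ) * Complex.I)).re) := by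
  set P := psi α δ l with hPd
  have h0 := S.a0
  have hP : 0 ≤ P.re := psi_re_nonneg _ _ _
  have hin : ∀ a b : ℝ, Integrable (fun y : ℝ => Complex.exp (((a * y + b : ℝ) : ℂ) * Complex.I)) μ := by
    intro a b
    refine Integrable.of_bound (C := 1) (by fun_prop) (Eventually.of_forall fun y => ?_)
    rw [Complex.norm_exp_ofReal_mul_I]
  have hin' : ∀ a : ℝ, Integrable (fun y : ℝ => Complex.exp (((a * y : ℝ) : ℂ) * Complex.I)) μ := by
    intro a; simpa using hin a 0
  have hG : ∀ t x, 0 ≤ t → GG α μ (fun x => (z * Complex.exp (((l * x : ℝ) : ℂ) * Complex.I)).re) t x =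
      (z * (EE α P l t x - Complex.exp (-P))).re := by
    intro t x ht
    unfold GG
    have e : ∀ y : ℝ, (z * Complex.exp (((l * (sg α t * y + ee α t * x) : ℝ) : ℂ) * Complex.I)).re
        - (z * Complex.exp (((l * y : ℝ) : ℂ) * Complex.I)).re
        = (z * (Complex.exp (((l * ee α t * x : ℝ) : ℂ) * Complex.I) * Complex.exp (((sg α t * l * y : ℝ) : ℂ) * Complex.I)
          - Complex.exp (((l * y : ℝ) : ℂ) * Complex.I))).re := by
      intro y
      rw [← Complex.exp_add, mul_sub]
      rw [Complex.sub_re]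
      congr 4
      push_cast; ring
    simp_rw [e]
    have hin2 : ∀ (w : ℂ) (a b : ℝ), Integrable (fun y : ℝ => w * Complex.exp (((a * y : ℝ) : ℂ) * Complex.I)
        - Complex.exp (((b * y : ℝ) : ℂ) * Complex.I)) μ := fun w a b => ((hin' a).const_mul w).sub (hin' b)
    rw [int_re ((hin2 _ _ _).const_mul z), integral_const_mul,
      integral_sub ((hin' _).const_mul _) (hin' _), integral_const_mul, hZ, hZ]
    have hs : 0 ≤ 1 - Real.exp (-t) := by
      have : Real.exp (-t) ≤ 1 := by rw [Real.exp_le_one_iff]; linarith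
      linarith
    have hsg : 0 ≤ sg α t := Real.rpow_nonneg hs _
    rw [psi_smul h0 _ hsg]
    have : sg α t ^ α = 1 - Real.exp (-t) := by
      unfold sg; rw [← Real.rpow_mul hs]; rw [one_div_mul_cancel h0.ne', Real.rpow_one]
    rw [this, ← Complex.exp_add]
    congr 3
    unfold EE
    congr 1
    rw [← hPd]; ring
  have hF : FF α μ (fun x => (z * Complex.exp (((l * x : ℝ) : ℂ) * Complex.I)).re) = fun x => (z * FC α P l x).re := by
    ext x
    unfold FF FC
    rw [setIntegral_congr_fun measurableSet_Ioi (fun t ht => hG t x (le_of_lt ht)), mul_neg, Complex.neg_re, ← integral_const_mul]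
    congr 1
    exact integral_re ((EE_int h0 S.a1 hP l x).const_mul z)
  intro x
  rw [hF]
  have hd : HasDerivAt (fun x => (z * FC α P l x).re) (z * deriv (FC α P l) x).re x := by
    have := ((FC_dx h0 S.a1 hP l x).differentiableAt.hasDerivAt).const_mul z
    exact Complex.reCLM.hasFDerivAt.comp_hasDerivAt x this
  rw [hd.deriv]
  have hI : ∫ y, (z * Complex.exp (((l * y : ℝ) : ℂ) * Complex.I)).re ∂μ = (z * Complex.exp (-P)).re := by
    rw [← hZ, ← integral_const_mul]
    exact integral_re ((hin' l).const_mul z)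
  obtain ⟨g1, g2⟩ := FC_gen h0 S.a1 D l x
  have hL : LL c N (fun x => (z * FC α P l x).re) x = (z * ∫ u, ((FC α P l (x + u) - FC α P l x)
      + c * (FC α P l (x - u) - FC α P l x)) * (N u : ℂ)).re := by
    rw [← integral_const_mul]
    refine Eq.trans ?_ (int_re (g1.const_mul z))
    unfold LL DD
    congr 1
    ext u
    rw [show z * (((FC α P l (x + u) - FC α P l x) + c * (FC α P l (x - u) - FC α P l x)) * (N u : ℂ)) =
      (((z * FC α P l (x + u) - z * FC α P l x) + c * (z * FC α P l (x - u) - z * FC α P l x))) * (N u : ℂ) by ring,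
      Complex.re_mul_ofReal, Complex.add_re, Complex.re_ofReal_mul, Complex.sub_re, Complex.sub_re]
  have key := FC_eq h0 S.a1 D l x
  rw [hL, hI, ← Complex.re_ofReal_mul, ← Complex.sub_re, ← Complex.sub_re, ← mul_sub, ← key]
  congr 1; ring

set_option linter.unusedSectionVars false
set_option linter.unusedVariables false

/-- de la Vallée Poussin weight -/
def ww (s : ℝ) : ℝ := (1 + Real.cos s) / 2

lemma ww_cont : Continuous ww := by unfold ww; fun_prop

lemma ww_nonneg (s : ℝ) : 0 ≤ ww s := by unfold ww; linarith [Real.neg_one_le_cos s]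

lemma ww_pow (n : ℕ) (s : ℝ) : ((ww s ^ n : ℝ) : ℂ) =
    ∑ k ∈ Finset.range (2 * n + 1), ((4:ℂ)⁻¹ ^ n * ((2 * n).choose k : ℂ)) *
      Complex.exp (((((k:ℝ) - n) * s : ℝ) : ℂ) * Complex.I) := by
  have e1 : ((ww s : ℝ) : ℂ) = (4:ℂ)⁻¹ * Complex.exp (-(s * Complex.I)) * (Complex.exp (s * Complex.I) + 1) ^ 2 := by
    have h : Complex.exp (-(s * Complex.I)) * Complex.exp (s * Complex.I) = 1 := by
      rw [← Complex.exp_add]; simp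
    unfold ww
    push_cast
    rw [Complex.cos, show -(s:ℂ) * Complex.I = -(s * Complex.I) by ring]
    linear_combination (-(1:ℂ)/4) * (Complex.exp (s * Complex.I) + 2) * h
  rw [Complex.ofReal_pow, e1, mul_pow, mul_pow, ← pow_mul, add_pow, Finset.mul_sum]
  refine Finset.sum_congr rfl fun k _ => ?_
  rw [one_pow, mul_one, ← Complex.exp_nat_mul, ← Complex.exp_nat_mul]
  have : Complex.exp (((((k:ℝ) - n) * s : ℝ) : ℂ) * Complex.I) =
      Complex.exp (n * -(s * Complex.I)) * Complex.exp (k * (s * Complex.I)) := by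
    rw [← Complex.exp_add]; congr 1; push_cast; ring
  rw [this]; ring

/-- averaged function -/
def av (R : ℝ) (g : ℝ → ℝ) (n : ℕ) (x : ℝ) : ℝ :=
  (∫ s in Icc (-π) π, ww s ^ n)⁻¹ * ∫ s in Icc (-π) π, ww s ^ n * g (x - R * s)

lemma av_memC {β C R : ℝ} {g : ℝ → ℝ} (H : memC β C g) (n : ℕ) : memC β C (av R g n) := by
  intro x y
  have hc := H.cont
  have hw := ww_cont
  have i : ∀ x, IntegrableOn (fun s => ww s ^ n * g (x - R * s)) (Icc (-π) π) := fun x =>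
    (by fun_prop : Continuous fun s => ww s ^ n * g (x - R * s)).continuousOn.integrableOn_compact isCompact_Icc
  have i0 : IntegrableOn (fun s => ww s ^ n) (Icc (-π) π) :=
    (by fun_prop : Continuous fun s => ww s ^ n).continuousOn.integrableOn_compact isCompact_Icc
  have hA : 0 ≤ ∫ s in Icc (-π) π, ww s ^ n := integral_nonneg fun s => pow_nonneg (ww_nonneg s) _
  unfold av
  set A := ∫ s in Icc (-π) π, ww s ^ n with hAd
  set m := C * min |x - y| (|x - y| ^ β) with hm
  have hm0 : 0 ≤ m := mul_nonneg H.nonneg (by positivity)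
  rw [← mul_sub, ← integral_sub (i x) (i y), abs_mul, abs_of_nonneg (inv_nonneg.mpr hA)]
  have : |∫ s in Icc (-π) π, (ww s ^ n * g (x - R * s) - ww s ^ n * g (y - R * s))| ≤ A * m := by
    have := norm_integral_le_of_norm_le (μ := volume.restrict (Icc (-π) π))
      (f := fun s => (ww s ^ n * g (x - R * s) - ww s ^ n * g (y - R * s))) (i0.mul_const m)
      (Eventually.of_forall fun s => by
        rw [← mul_sub, norm_mul, Real.norm_of_nonneg (pow_nonneg (ww_nonneg s) _)]
        refine mul_le_mul_of_nonneg_left ?_ (pow_nonneg (ww_nonneg s) _)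
        have := H (x - R * s) (y - R * s)
        rwa [show x - R * s - (y - R * s) = x - y by ring] at this)
    rwa [integral_mul_const] at this
  calc _ ≤ A⁻¹ * (A * m) := by gcongr
    _ = (A⁻¹ * A) * m := by ring
    _ ≤ 1 * m := by gcongr; exact inv_mul_le_one
    _ = m := one_mul m

lemma av_tendsto {R : ℝ} {g : ℝ → ℝ} (hc : Continuous g) (x : ℝ) :
    Tendsto (fun n => av R g n x) atTop (𝓝 (g x)) := by
  have hpi := Real.pi_pos
  have := tendsto_setIntegral_pow_smul_of_unique_maximum_of_isCompact_of_continuousOn (μ := volume)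
    (isCompact_Icc (a := -π) (b := π)) (c := ww) (x₀ := 0) (g := fun s => g (x - R * s)) ww_cont.continuousOn
    (by
      intro y hy h0
      have h1 : Real.cos y ≠ 1 := by
        rw [Ne, Real.cos_eq_one_iff_of_lt_of_lt (by linarith [hy.1]) (by linarith [hy.2])]
        exact h0
      have := lt_of_le_of_ne (Real.cos_le_one y) h1
      unfold ww; rw [Real.cos_zero]; linarith)
    (fun y _ => ww_nonneg y) (by unfold ww; norm_num)
    (by
      rw [interior_Icc, closure_Ioo (by linarith)]
      constructor <;> linarith)
    (by fun_prop)
  simpa [av] using this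

lemma av_trig {R : ℝ} (hR : 0 < R) {g : ℝ → ℝ} (hc : Continuous g) (hg : ∀ x, g (x + 2 * π * R) = g x) (n : ℕ) :
    ∃ z : ℕ → ℂ, ∀ x, av R g n x = ∑ k ∈ Finset.range (2 * n + 1),
      (z k * Complex.exp ((((((k:ℝ) - n) / R) * x : ℝ) : ℂ) * Complex.I)).re := by
  have hpi := Real.pi_pos
  have hw := ww_cont
  set A := ∫ s in Icc (-π) π, ww s ^ n with hAd
  refine ⟨fun k => (A⁻¹ : ℝ) * (((4:ℂ)⁻¹ ^ n * ((2 * n).choose k : ℂ)) *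
    ∫ s in (-π)..π, Complex.exp (((-(((k:ℝ) - n) * s) : ℝ) : ℂ) * Complex.I) * (g (R * s) : ℂ)), fun x => ?_⟩
  have e1 : ∫ s in Icc (-π) π, ww s ^ n * g (x - R * s) = ∫ s in (-π)..π, ww (x / R - s) ^ n * g (R * s) := by
    rw [integral_Icc_eq_integral_Ioc, ← intervalIntegral.integral_of_le (by linarith)]
    have a1 : ∀ s, ww s ^ n * g (x - R * s) = (fun r => ww (x / R - r) ^ n * g (R * r)) (x / R - s) := by
      intro s
      simp only [sub_sub_cancel]
      congr 2; field_simp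
    simp_rw [a1]
    rw [intervalIntegral.integral_comp_sub_left (fun r => ww (x / R - r) ^ n * g (R * r))]
    have per : Function.Periodic (fun r => ww (x / R - r) ^ n * g (R * r)) (2 * π) := by
      intro r
      simp only
      rw [mul_add, show R * (2 * π) = 2 * π * R by ring, hg]
      congr 2
      unfold ww
      rw [show x / R - (r + 2 * π) = x / R - r - 2 * π by ring, Real.cos_sub_two_pi]
    have := per.intervalIntegral_add_eq (x / R - π) (-π)
    rw [show x / R - π + 2 * π = x / R - -π by ring, show -π + 2 * π = π by ring] at this
    exact this
  have e2 : ((av R g n x : ℝ) : ℂ) = ∑ k ∈ Finset.range (2 * n + 1), ((A⁻¹ : ℝ) * (((4:ℂ)⁻¹ ^ n * ((2 * n).choose k : ℂ)) *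
    ∫ s in (-π)..π, Complex.exp (((-(((k:ℝ) - n) * s) : ℝ) : ℂ) * Complex.I) * (g (R * s) : ℂ))) *
      Complex.exp ((((((k:ℝ) - n) / R) * x : ℝ) : ℂ) * Complex.I) := by
    unfold av
    rw [e1, Complex.ofReal_mul, ← intervalIntegral.integral_ofReal]
    simp_rw [Complex.ofReal_mul _ (g _), ww_pow, Finset.sum_mul]
    rw [intervalIntegral.integral_finsetSum, Finset.mul_sum]
    · refine Finset.sum_congr rfl fun k _ => ?_
      have : ∀ s : ℝ, (4:ℂ)⁻¹ ^ n * ((2 * n).choose k : ℂ) * Complex.exp (((((k:ℝ) - n) * (x / R - s) : ℝ) : ℂ) * Complex.I) * (g (R * s) : ℂ)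
        = ((4:ℂ)⁻¹ ^ n * ((2 * n).choose k : ℂ) * Complex.exp ((((((k:ℝ) - n) / R) * x : ℝ) : ℂ) * Complex.I)) *
          (Complex.exp (((-(((k:ℝ) - n) * s) : ℝ) : ℂ) * Complex.I) * (g (R * s) : ℂ)) := by
        intro s
        have : Complex.exp (((((k:ℝ) - n) * (x / R - s) : ℝ) : ℂ) * Complex.I) =
          Complex.exp ((((((k:ℝ) - n) / R) * x : ℝ) : ℂ) * Complex.I) * Complex.exp (((-(((k:ℝ) - n) * s) : ℝ) : ℂ) * Complex.I) := by
          rw [← Complex.exp_add]; congr 1; push_cast; ring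
        rw [this]; ring
      simp_rw [this]
      rw [intervalIntegral.integral_const_mul]
      ring
    · intro k _
      refine Continuous.intervalIntegrable ?_ _ _
      fun_prop
  have := congrArg Complex.re e2
  rw [Complex.ofReal_re, Complex.re_sum] at this
  exact this

lemma memC_sin {β C R : ℝ} (hb : 0 < β) (hR : 0 < R) {h : ℝ → ℝ} (H : memC β C h) :
    memC β C (fun x => h (R * Real.sin (x / R))) := by
  intro x y
  refine (H _ _).trans ?_
  have h1 : |R * Real.sin (x / R) - R * Real.sin (y / R)| ≤ |x - y| := by
    rw [← mul_sub, abs_mul, abs_of_pos hR]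
    calc R * |Real.sin (x / R) - Real.sin (y / R)| ≤ R * |x / R - y / R| := by
          exact mul_le_mul_of_nonneg_left (Real.abs_sin_sub_sin_le _ _) hR.le
      _ = |x - y| := by rw [← sub_div, abs_div, abs_of_pos hR]; field_simp
  have := H.nonneg
  gcongr

lemma tendsto_sin_scale (x : ℝ) :
    Tendsto (fun m : ℕ => ((m:ℝ) + 1) * Real.sin (x / ((m:ℝ) + 1))) atTop (𝓝 x) := by
  have e : ∀ m : ℕ, x * Real.sinc (x / ((m:ℝ) + 1)) = ((m:ℝ) + 1) * Real.sin (x / ((m:ℝ) + 1)) := by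
    intro m
    rcases eq_or_ne x 0 with h | h
    · simp [h]
    · have : (0:ℝ) < (m:ℝ) + 1 := by positivity
      rw [Real.sinc_of_ne_zero (by positivity)]
      field_simp
  simp_rw [← e]
  have h1 : Tendsto (fun m : ℕ => x / ((m:ℝ) + 1)) atTop (𝓝 0) :=
    tendsto_const_nhds.div_atTop (tendsto_atTop_add_const_right _ _ tendsto_natCast_atTop_atTop)
  have h2 := (Real.continuous_sinc.tendsto 0).comp h1
  rw [Real.sinc_zero] at h2
  simpa using h2.const_mul x

lemma INTG_all {α β δ c : ℝ} {N K : ℝ → ℝ} {μ : Measure ℝ} [IsProbabilityMeasure μ] (S : Setup α β μ)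
    (D : LevyData α (psi α δ) c N) (B : KB α β μ c N K)
    (hZ : ∀ l : ℝ, ∫ x : ℝ, Complex.exp (((l * x : ℝ) : ℂ) * Complex.I) ∂μ = Complex.exp (-psi α δ l))
    {C : ℝ} {h : ℝ → ℝ} (H : memC β C h) : INTG α μ c N h := by
  have hc := H.cont
  refine INTG.lim S B (C := C) (hn := fun m x => h (((m:ℝ) + 1) * Real.sin (x / ((m:ℝ) + 1))))
    (fun m => memC_sin S.b0 (by positivity) H) (fun x => (hc.tendsto x).comp (tendsto_sin_scale x)) fun m => ?_
  have hR : (0:ℝ) < (m:ℝ) + 1 := by positivity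
  generalize (m:ℝ) + 1 = R at hR
  have H2 := memC_sin S.b0 hR H
  refine INTG.lim S B (C := C) (hn := fun n => av R (fun x => h (R * Real.sin (x / R))) n) (fun n => av_memC H2 n)
    (fun x => av_tendsto H2.cont x) fun n => ?_
  refine PW.toINT S B (av_memC H2 n) ?_
  obtain ⟨z, hz⟩ := av_trig hR H2.cont (fun x => by
    rw [show (x + 2 * π * R) / R = x / R + 2 * π by field_simp, Real.sin_add_two_pi]) n
  rw [funext hz]
  exact (PW.sum S B (fun k => ⟨_, memC_exp S.b0 S.b1 (z k) (((k:ℝ) - n) / R)⟩)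
    (fun k => PW_exp S D hZ (z k) (((k:ℝ) - n) / R)) (2 * n + 1)).2

set_option linter.unusedSectionVars false
set_option linter.unusedVariables false

/-- Cauchy density -/
def qq (y : ℝ) : ℝ := π⁻¹ * (1 + y ^ 2)⁻¹

lemma qq_pos (y : ℝ) : 0 < qq y := by unfold qq; positivity

lemma qq_int : Integrable qq := integrable_inv_one_add_sq.const_mul _

lemma qq_cont : Continuous qq := by
  unfold qq
  have : ∀ y : ℝ, 1 + y ^ 2 ≠ 0 := fun y => by positivity
  fun_prop (disch := assumption)

lemma qq_val : ∫ y, qq y = 1 := by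
  unfold qq
  rw [integral_const_mul, integral_univ_inv_one_add_sq]
  exact inv_mul_cancel₀ Real.pi_ne_zero

lemma qq_fourier_aux (w : ℝ) :
    Integrable (fun v : ℝ => Complex.exp (↑(-2 * π * v * w) * Complex.I) • ((Real.exp (-(2 * π * |v|)) : ℝ) : ℂ)) ∧
    ∫ v : ℝ, Complex.exp (↑(-2 * π * v * w) * Complex.I) • ((Real.exp (-(2 * π * |v|)) : ℝ) : ℂ) = ((qq w : ℝ) : ℂ) := by
  have hp := Real.pi_pos
  set a : ℂ := -(2 * π) - (2 * π * w) * Complex.I with ha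
  set b : ℂ := -(2 * π) + (2 * π * w) * Complex.I with hb
  have ra : a.re < 0 := by simp [ha, hp]
  have rb : b.re < 0 := by simp [hb, hp]
  have e1 : ∀ v ∈ Ioi (0:ℝ), Complex.exp (a * v) =
      Complex.exp (↑(-2 * π * v * w) * Complex.I) • ((Real.exp (-(2 * π * |v|)) : ℝ) : ℂ) := by
    intro v hv
    rw [abs_of_pos hv, smul_eq_mul, Complex.ofReal_exp, ← Complex.exp_add, ha]
    congr 1; push_cast; ring
  have e2 : ∀ v ∈ Ioi (0:ℝ), Complex.exp (b * v) =
      Complex.exp (↑(-2 * π * (-v) * w) * Complex.I) • ((Real.exp (-(2 * π * |(-v)|)) : ℝ) : ℂ) := by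
    intro v hv
    rw [abs_neg, abs_of_pos hv, smul_eq_mul, Complex.ofReal_exp, ← Complex.exp_add, hb]
    congr 1; push_cast; ring
  have i1 := (integrableOn_exp_mul_complex_Ioi ra 0).congr_fun e1 measurableSet_Ioi
  have i2 := (integrableOn_exp_mul_complex_Ioi rb 0).congr_fun e2 measurableSet_Ioi
  obtain ⟨j1, j2⟩ := integrable_of_halves i1 i2
  refine ⟨j1, ?_⟩
  rw [j2, ← setIntegral_congr_fun measurableSet_Ioi e1, ← setIntegral_congr_fun measurableSet_Ioi e2,
    integral_exp_mul_complex_Ioi ra, integral_exp_mul_complex_Ioi rb]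
  have a0 : a ≠ 0 := fun h => by rw [h] at ra; simp at ra
  have b0 : b ≠ 0 := fun h => by rw [h] at rb; simp at rb
  have hw : (1 + (w:ℂ) ^ 2) ≠ 0 := by
    have : (1 + w ^ 2) ≠ 0 := by positivity
    exact_mod_cast this
  have hpc : (π : ℂ) ≠ 0 := by exact_mod_cast Real.pi_ne_zero
  have hab : a * b = 4 * π ^ 2 * (1 + (w:ℂ) ^ 2) := by
    rw [ha, hb]; ring_nf; rw [Complex.I_sq]; ring
  have hs : a + b = -(4 * π) := by rw [ha, hb]; ring
  unfold qq
  push_cast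
  have : -1 / a + -1 / b = -(a + b) / (a * b) := by field_simp; ring
  simp only [mul_zero, Complex.exp_zero]
  rw [this, hab, hs]
  field_simp

lemma qq_cf (l : ℝ) : ∫ y : ℝ, Complex.exp (((l * y : ℝ) : ℂ) * Complex.I) * ((qq y : ℝ) : ℂ) =
    ((Real.exp (-|l|) : ℝ) : ℂ) := by
  set E : ℝ → ℂ := fun v => ((Real.exp (-(2 * π * |v|)) : ℝ) : ℂ) with hE
  have hF : FourierTransform.fourier E = fun w => ((qq w : ℝ) : ℂ) := by
    funext w
    rw [Real.fourier_real_eq_integral_exp_smul]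
    exact (qq_fourier_aux w).2
  have hEi : Integrable E := by
    have := (qq_fourier_aux 0).1
    simpa [hE] using this
  have hEc : Continuous E := by rw [hE]; fun_prop
  have := Continuous.fourierInv_fourier_eq hEc hEi (by rw [hF]; exact qq_int.ofReal)
  have h2 := congrFun this (l / (2 * π))
  rw [hF, Real.fourierInv_eq'] at h2
  have hp := Real.pi_pos
  rw [hE] at h2
  simp only [smul_eq_mul] at h2
  rw [show -(2 * π * |l / (2 * π)|) = -|l| by
    rw [abs_div, abs_of_pos (show 0 < 2 * π by positivity)]; field_simp] at h2
  rw [← h2]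
  congr 1; funext y
  congr 3
  simp
  field_simp

lemma cauchy_unique {μ : Measure ℝ} [IsProbabilityMeasure μ]
    (hZ : ∀ l : ℝ, ∫ x : ℝ, Complex.exp (((l * x : ℝ) : ℂ) * Complex.I) ∂μ = ((Real.exp (-|l|) : ℝ) : ℂ)) :
    μ = volume.withDensity (fun y => ENNReal.ofReal (qq y)) := by
  haveI : IsFiniteMeasure (volume.withDensity (fun y => ENNReal.ofReal (qq y))) :=
    isFiniteMeasure_withDensity_ofReal qq_int.2
  apply Measure.ext_of_charFun
  funext l
  rw [charFun_apply_real, charFun_apply_real,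
    integral_withDensity_eq_integral_toReal_smul (by exact qq_cont.measurable.ennreal_ofReal) (by simp)]
  have := (hZ l).trans (qq_cf l).symm
  push_cast at this
  rw [this]
  congr 1; funext y
  rw [ENNReal.toReal_ofReal (qq_pos y).le, Complex.real_smul, mul_comm]

lemma qq_shift (s y : ℝ) : |qq (y - s) - qq y| ≤ Real.sqrt |s| * (qq (y - s) + qq y) := by
  have h1 : |qq (y - s) - qq y| ≤ (qq (y - s) + qq y) := by
    rw [abs_le]; constructor <;> linarith [qq_pos (y-s), qq_pos y]
  have h2 : |qq (y - s) - qq y| ≤ |s| / 2 * (qq (y - s) + qq y) := by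
    have hA : 0 < 1 + (y - s)^2 := by positivity
    have hB : 0 < 1 + y^2 := by positivity
    have hp := Real.pi_pos
    unfold qq
    have e : π⁻¹ * (1 + (y - s) ^ 2)⁻¹ - π⁻¹ * (1 + y ^ 2)⁻¹ =
      π⁻¹ * (s * (y + (y - s))) * ((1 + (y - s) ^ 2)⁻¹ * (1 + y ^ 2)⁻¹) := by field_simp; ring
    have e' : |s| / 2 * (π⁻¹ * (1 + (y - s) ^ 2)⁻¹ + π⁻¹ * (1 + y ^ 2)⁻¹) =
      π⁻¹ * (|s| * (((1 + y^2) + (1 + (y-s)^2)) / 2)) * ((1 + (y - s) ^ 2)⁻¹ * (1 + y ^ 2)⁻¹) := by field_simp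
    rw [e, e', abs_mul, abs_mul, abs_mul, abs_of_pos (show 0 < π⁻¹ by positivity),
      abs_of_pos (show 0 < (1 + (y - s) ^ 2)⁻¹ * (1 + y ^ 2)⁻¹ by positivity)]
    gcongr
    rw [abs_le]; constructor <;> nlinarith [sq_nonneg (y-1), sq_nonneg (y+1), sq_nonneg (y-s-1), sq_nonneg (y-s+1)]
  have h3 : 0 < qq (y - s) + qq y := by linarith [qq_pos (y-s), qq_pos y]
  have hs := Real.sqrt_nonneg |s|
  have hs2 := Real.mul_self_sqrt (abs_nonneg s)
  rcases le_total 1 (Real.sqrt |s|) with h | h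
  · nlinarith
  · refine h2.trans ?_
    gcongr
    nlinarith

lemma qq_phi {φ : ℝ → ℝ} (hm : Measurable φ) {C : ℝ} (hC : ∀ y, |φ y| ≤ C) (s : ℝ) :
    |(∫ y, qq y * φ (y + s)) - ∫ y, qq y * φ y| ≤ 2 * C * Real.sqrt |s| := by
  have C0 : 0 ≤ C := (abs_nonneg _).trans (hC 0)
  have qs : Integrable (fun y => qq (y - s)) := qq_int.comp_sub_right s
  have e : ∫ y, qq y * φ (y + s) = ∫ y, qq (y - s) * φ y := by
    rw [← integral_sub_right_eq_self (fun y => qq y * φ (y + s)) s]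
    simp
  have i1 : Integrable (fun y => qq (y - s) * φ y) :=
    qs.mul_bdd (c := C) hm.aestronglyMeasurable (ae_of_all _ fun y => hC y)
  have i2 : Integrable (fun y => qq y * φ y) :=
    qq_int.mul_bdd (c := C) hm.aestronglyMeasurable (ae_of_all _ fun y => hC y)
  rw [e, ← integral_sub i1 i2, ← Real.norm_eq_abs]
  have i3 : Integrable (fun y => Real.sqrt |s| * C * (qq (y - s) + qq y)) := (qs.add qq_int).const_mul _
  refine (norm_integral_le_of_norm_le i3 (ae_of_all _ fun y => ?_)).trans (le_of_eq ?_)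
  · rw [← sub_mul, norm_mul, Real.norm_eq_abs, Real.norm_eq_abs]
    calc _ ≤ (Real.sqrt |s| * (qq (y - s) + qq y)) * C :=
          mul_le_mul (qq_shift s y) (hC y) (abs_nonneg _) (by
            have := qq_pos (y-s); have := qq_pos y; positivity)
      _ = _ := by ring
  · rw [integral_const_mul, integral_add qs qq_int, integral_sub_right_eq_self qq s, qq_val]; ring

set_option linter.unusedSectionVars false
set_option linter.unusedVariables false

lemma sg_one (t : ℝ) : sg 1 t = 1 - Real.exp (-t) := by simp [sg]
lemma ee_one (t : ℝ) : ee 1 t = Real.exp (-t) := by simp [ee]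

lemma wt_int : IntegrableOn (fun t : ℝ => Real.exp (-t) / Real.sqrt (1 - Real.exp (-t))) (Ioi 0) ∧
    ∫ t in Ioi (0:ℝ), Real.exp (-t) / Real.sqrt (1 - Real.exp (-t)) = 2 := by
  have hc : ContinuousWithinAt (fun t : ℝ => 2 * Real.sqrt (1 - Real.exp (-t))) (Ici 0) 0 := by
    apply Continuous.continuousWithinAt; fun_prop
  have hd : ∀ t ∈ Ioi (0:ℝ), HasDerivAt (fun t : ℝ => 2 * Real.sqrt (1 - Real.exp (-t)))
      (Real.exp (-t) / Real.sqrt (1 - Real.exp (-t))) t := by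
    intro t ht
    have h1 : 0 < 1 - Real.exp (-t) := by
      have : Real.exp (-t) < 1 := by rw [Real.exp_lt_one_iff]; linarith [mem_Ioi.mp ht]
      linarith
    have h2 : HasDerivAt (fun t : ℝ => 1 - Real.exp (-t)) (Real.exp (-t)) t := by
      have := ((hasDerivAt_neg t).exp).const_sub 1
      simpa using this
    have := (h2.sqrt h1.ne').const_mul 2
    have e : 2 * (Real.exp (-t) / (2 * Real.sqrt (1 - Real.exp (-t)))) = Real.exp (-t) / Real.sqrt (1 - Real.exp (-t)) := by
      have := Real.sqrt_pos.mpr h1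
      field_simp
    rw [e] at this
    exact this
  have hn : ∀ t ∈ Ioi (0:ℝ), 0 ≤ Real.exp (-t) / Real.sqrt (1 - Real.exp (-t)) := fun t _ => by positivity
  have hl : Tendsto (fun t : ℝ => 2 * Real.sqrt (1 - Real.exp (-t))) atTop (𝓝 2) := by
    have h1 : Tendsto (fun t : ℝ => Real.exp (-t)) atTop (𝓝 0) := Real.tendsto_exp_neg_atTop_nhds_zero
    have := ((Real.continuous_sqrt.tendsto _).comp (h1.const_sub 1)).const_mul 2
    simpa [Function.comp_def] using this
  refine ⟨integrableOn_Ioi_deriv_of_nonneg hc hd hn hl, ?_⟩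
  rw [integral_Ioi_of_hasDerivAt_of_nonneg hc hd hn hl]
  simp

section
variable {β : ℝ} {μ : Measure ℝ} [IsProbabilityMeasure μ]

lemma GD_holder (hμ : μ = volume.withDensity (fun y => ENNReal.ofReal (qq y)))
    {C : ℝ} {h : ℝ → ℝ} (H : memC β C h) {t : ℝ} (ht : 0 < t) (x u : ℝ) :
    |GD 1 μ h t (x + u) - GD 1 μ h t x| ≤
      2 * C * Real.sqrt |u| * (Real.exp (-t) / Real.sqrt (1 - Real.exp (-t))) := by
  have hs : 0 < sg 1 t := sg_pos ht
  have he := ee_pos 1 t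
  have C0 := H.nonneg
  have key : ∀ g : ℝ → ℝ, ∫ y, g y ∂μ = ∫ y, qq y * g y := by
    intro g
    rw [hμ, integral_withDensity_eq_integral_toReal_smul (by exact qq_cont.measurable.ennreal_ofReal) (by simp)]
    congr 1; funext y
    rw [ENNReal.toReal_ofReal (qq_pos y).le, smul_eq_mul]
  have hm : Measurable (fun y => deriv h (sg 1 t * y + ee 1 t * x)) := by
    have := measurable_deriv h
    fun_prop
  have := qq_phi hm (fun y => H.deriv_le _) (ee 1 t * u / sg 1 t)
  unfold GD
  rw [key, key, ← mul_sub, abs_mul, abs_of_pos he]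
  have e : (fun y => qq y * deriv h (sg 1 t * y + ee 1 t * (x + u))) =
      (fun y => qq y * deriv h (sg 1 t * (y + ee 1 t * u / sg 1 t) + ee 1 t * x)) := by
    funext y
    congr 2
    field_simp
    ring
  rw [e]
  refine (mul_le_mul_of_nonneg_left this he.le).trans ?_
  rw [abs_div, abs_mul, abs_of_pos hs, abs_of_pos he, Real.sqrt_div (by positivity), Real.sqrt_mul he.le, sg_one, ee_one]
  have h1 : Real.sqrt (Real.exp (-t)) ≤ 1 := by
    rw [Real.sqrt_le_one, Real.exp_le_one_iff]; linarith
  rw [sg_one] at hs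
  have h2 : 0 < Real.sqrt (1 - Real.exp (-t)) := Real.sqrt_pos.mpr hs
  calc _ = Real.sqrt (Real.exp (-t)) * (2 * C * Real.sqrt |u| * (Real.exp (-t) / Real.sqrt (1 - Real.exp (-t)))) := by ring
    _ ≤ 1 * (2 * C * Real.sqrt |u| * (Real.exp (-t) / Real.sqrt (1 - Real.exp (-t)))) := by gcongr
    _ = _ := one_mul _

lemma FF_deriv_holder (S : Setup 1 β μ) (hμ : μ = volume.withDensity (fun y => ENNReal.ofReal (qq y)))
    {C : ℝ} {h : ℝ → ℝ} (H : memC β C h) (x u : ℝ) :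
    |deriv (FF 1 μ h) (x + u) - deriv (FF 1 μ h) x| ≤ 4 * C * Real.sqrt |u| := by
  rw [(S.F6 H _).deriv, (S.F6 H _).deriv]
  have i1 := S.GDint H (x + u)
  have i2 := S.GDint H x
  rw [show ∀ a b : ℝ, -a - -b = -(a - b) by intros; ring, abs_neg, ← integral_sub i1 i2, ← Real.norm_eq_abs]
  refine (norm_integral_le_of_norm_le (wt_int.1.const_mul (2 * C * Real.sqrt |u|)) ?_).trans (le_of_eq ?_)
  · filter_upwards [ae_restrict_mem measurableSet_Ioi] with t ht
    exact GD_holder hμ H ht x u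
  · rw [integral_const_mul, wt_int.2]; ring

lemma FF_taylor (S : Setup 1 β μ) (hμ : μ = volume.withDensity (fun y => ENNReal.ofReal (qq y)))
    {C : ℝ} {h : ℝ → ℝ} (H : memC β C h) (x u : ℝ) :
    |FF 1 μ h (x + u) - FF 1 μ h x - u * deriv (FF 1 μ h) x| ≤ 4 * C * |u| ^ (3/2 : ℝ) := by
  have C0 := H.nonneg
  set f := FF 1 μ h
  set d := deriv f x
  have hd : ∀ v ∈ uIcc 0 u, HasDerivWithinAt (fun v => f (x + v) - f x - v * d) (deriv f (x + v) - d) (uIcc 0 u) v := by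
    intro v _
    have h1 : HasDerivAt f (deriv f (x + v)) (x + v) := (S.F6 H (x+v)).differentiableAt.hasDerivAt
    have h2 := ((h1.comp_const_add x v).sub_const (f x)).sub ((hasDerivAt_id v).mul_const d)
    have h3 : HasDerivAt (fun v => f (x + v) - f x - v * d) (deriv f (x + v) - d) v := by
      rw [mul_comm, mul_one] at h2
      exact h2
    exact h3.hasDerivWithinAt
  have hb : ∀ v ∈ uIcc 0 u, ‖deriv f (x + v) - d‖ ≤ 4 * C * Real.sqrt |u| := by
    intro v hv
    refine (FF_deriv_holder S hμ H x v).trans ?_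
    have : |v| ≤ |u| := by
      have := abs_sub_left_of_mem_uIcc hv
      simpa using this
    gcongr
  have := (convex_uIcc 0 u).norm_image_sub_le_of_norm_hasDerivWithin_le hd hb left_mem_uIcc right_mem_uIcc
  simp only [add_zero, sub_self, zero_mul, sub_zero, Real.norm_eq_abs] at this
  refine this.trans (le_of_eq ?_)
  rw [Real.sqrt_eq_rpow, mul_assoc]
  congr 1
  rcases eq_or_ne u 0 with rfl | hu
  · simp
  · rw [show (3/2:ℝ) = 1/2 + 1 by norm_num, Real.rpow_add (abs_pos.mpr hu), Real.rpow_one]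

lemma KB_one (S : Setup 1 β μ) (hμ : μ = volume.withDensity (fun y => ENNReal.ofReal (qq y))) :
    KB 1 β μ 1 (fun u => 1 / (2 * (π * u ^ 2))) (fun u => (8 + 2 / β) * min (|u| ^ (3/2:ℝ)) (|u| ^ β)) := by
  have b0 := S.b0
  have D := levyData_one 0
  refine ⟨D.meas, ?_, ?_⟩
  · intro C h H x u
    have C0 := H.nonneg
    have h1 : |DD 1 (FF 1 μ h) x u| ≤ 8 * C * |u| ^ (3/2:ℝ) := by
      have a1 := FF_taylor S hμ H x u
      have a2 := FF_taylor S hμ H x (-u)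
      rw [abs_neg] at a2
      unfold DD
      calc _ = |(FF 1 μ h (x + u) - FF 1 μ h x - u * deriv (FF 1 μ h) x) +
            (FF 1 μ h (x + -u) - FF 1 μ h x - -u * deriv (FF 1 μ h) x)| := by
              rw [← sub_eq_add_neg]; congr 1; ring
        _ ≤ _ := (abs_add_le _ _).trans (by linarith)
    have h2 : |DD 1 (FF 1 μ h) x u| ≤ 2 / β * C * |u| ^ β := by
      have a1 := (S.F3 H).leb (x + u) x
      have a2 := (S.F3 H).leb (x - u) x
      rw [show x + u - x = u by ring] at a1
      rw [show x - u - x = -u by ring, abs_neg] at a2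
      unfold DD
      rw [one_mul]
      refine (abs_add_le _ _).trans ((add_le_add a1 a2).trans (le_of_eq ?_))
      field_simp; ring
    have p1 : 0 ≤ |u| ^ (3/2:ℝ) := by positivity
    have p2 : 0 ≤ |u| ^ β := by positivity
    rw [← mul_assoc, mul_min_of_nonneg _ _ (by positivity)]
    have q0 : 0 ≤ 2 / β * C := by positivity
    refine le_min (h1.trans ?_) (h2.trans ?_)
    · apply mul_le_mul_of_nonneg_right _ p1; linarith
    · apply mul_le_mul_of_nonneg_right _ p2; linarith
  · obtain ⟨B, B0, hB⟩ := D.bound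
    have := (integrable_min_rpow_abs (a := 3/2) (b := β) (s := 1) S.ba (by norm_num)).const_mul ((8 + 2 / β) * B)
    refine this.mono' ?_ (ae_of_all _ fun u => ?_)
    · have := D.meas
      exact Measurable.aestronglyMeasurable (by fun_prop)
    · have m0 : 0 ≤ min (|u| ^ (3/2:ℝ)) (|u| ^ β) := by positivity
      rw [norm_mul, norm_mul, Real.norm_eq_abs, Real.norm_eq_abs, Real.norm_eq_abs, abs_abs,
        abs_of_nonneg m0, abs_of_pos (show 0 < 8 + 2 / β by positivity)]
      calc _ ≤ (8 + 2 / β) * min (|u| ^ (3/2:ℝ)) (|u| ^ β) * (B * |u| ^ (-1 - 1 : ℝ)) := by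
            gcongr; exact hB u
        _ = _ := by ring

lemma KB_lt {α δ : ℝ} (S : Setup α β μ) (h1 : α < 1) :
    KB α β μ 0 (nuDens α δ) (fun u => (1 / β) * min (|u| ^ (1:ℝ)) (|u| ^ β)) := by
  have b0 := S.b0
  have D := levyData_lt (δ := δ) S.a0 h1
  refine ⟨D.meas, ?_, ?_⟩
  · intro C h H x u
    have := S.F3 H (x + u) x
    rw [show x + u - x = u by ring] at this
    unfold DD
    rw [zero_mul, add_zero, Real.rpow_one]
    refine this.trans (le_of_eq ?_)
    ring
  · obtain ⟨B, B0, hB⟩ := D.bound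
    have := (integrable_min_rpow_abs (a := 1) (b := β) (s := α) S.ba h1).const_mul ((1 / β) * B)
    refine this.mono' ?_ (ae_of_all _ fun u => ?_)
    · have := D.meas
      exact Measurable.aestronglyMeasurable (by fun_prop)
    · have m0 : 0 ≤ min (|u| ^ (1:ℝ)) (|u| ^ β) := by positivity
      rw [norm_mul, norm_mul, Real.norm_eq_abs, Real.norm_eq_abs, Real.norm_eq_abs, abs_abs,
        abs_of_nonneg m0, abs_of_pos (show 0 < 1 / β by positivity)]
      calc _ ≤ (1 / β) * min (|u| ^ (1:ℝ)) (|u| ^ β) * (B * |u| ^ (-1 - α : ℝ)) := by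
            gcongr; exact hB u
        _ = _ := by ring

lemma Lop1_eq (S : Setup 1 β μ) (hμ : μ = volume.withDensity (fun y => ENNReal.ofReal (qq y)))
    {C : ℝ} {h : ℝ → ℝ} (H : memC β C h) (x : ℝ) :
    Lop1 (FF 1 μ h) x = LL 1 (fun u => 1 / (2 * (π * u ^ 2))) (FF 1 μ h) x := by
  have b0 := S.b0
  have C0 := H.nonneg
  have hp := Real.pi_pos
  set f := FF 1 μ h with hf
  set A : ℝ → ℝ := fun u => (f (x + u) - f x - (if |u| ≤ 1 then u * deriv f x else 0)) * (1 / (π * u ^ 2)) with hA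
  have fc : Continuous f := (S.F3 H).cont
  have iA : Integrable A := by
    have := (integrable_min_rpow_abs (a := 3/2) (b := β) (s := 1) S.ba (by norm_num)).const_mul ((4 * C + C / β) * π⁻¹)
    refine this.mono' ?_ (ae_of_all _ fun u => ?_)
    · refine Measurable.aestronglyMeasurable ?_
      refine Measurable.mul ?_ (by fun_prop)
      refine Measurable.sub (by fun_prop) ?_
      exact Measurable.ite (measurableSet_le (by fun_prop) (by fun_prop)) (by fun_prop) (by fun_prop)
    · rcases eq_or_ne u 0 with rfl | hu
      · simp [hA]; positivity
      have hu' : 0 < |u| := abs_pos.mpr hu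
      have e1 : ‖1 / (π * u ^ 2)‖ = π⁻¹ * |u| ^ (-1 - 1 : ℝ) := by
        rw [show (-1 - 1 : ℝ) = -(2:ℕ) by norm_num, Real.rpow_neg hu'.le, Real.rpow_natCast, sq_abs,
          Real.norm_eq_abs, abs_of_pos (by positivity)]
        field_simp
      rw [hA]
      simp only
      rw [norm_mul, e1]
      have : ‖f (x + u) - f x - (if |u| ≤ 1 then u * deriv f x else 0)‖ ≤ (4 * C + C / β) * min (|u| ^ (3/2:ℝ)) (|u| ^ β) := by
        have q0 : 0 ≤ C / β := by positivity
        rw [Real.norm_eq_abs]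
        split_ifs with hle
        · rw [min_eq_left (Real.rpow_le_rpow_of_exponent_ge hu' hle (by linarith [S.ba]))]
          refine (FF_taylor S hμ H x u).trans ?_
          gcongr; linarith
        · rw [min_eq_right (Real.rpow_le_rpow_of_exponent_le (by linarith) (by linarith [S.ba])), sub_zero]
          have a1 := (S.F3 H).leb (x + u) x
          rw [show x + u - x = u by ring] at a1
          refine a1.trans ?_
          gcongr; linarith
      calc _ ≤ (4 * C + C / β) * min (|u| ^ (3/2:ℝ)) (|u| ^ β) * (π⁻¹ * |u| ^ (-1 - 1 : ℝ)) := by gcongr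
        _ = _ := by ring
  have e : ∀ u, DD 1 f x u * (1 / (2 * (π * u ^ 2))) = 1 / 2 * (A u + A (-u)) := by
    intro u
    simp only [hA, DD, abs_neg, neg_sq, ← sub_eq_add_neg]
    split_ifs <;> field_simp <;> ring
  have iA' : Integrable (fun u => A (-u)) := iA.comp_neg
  have hL : Lop1 f x = ∫ u, A u := rfl
  unfold LL
  simp_rw [e]
  rw [hL, integral_const_mul, integral_add iA iA', integral_neg_eq_self A volume]
  ring

end

set_option linter.unusedSectionVars false
set_option linter.unusedVariables false

/-- Lemma 2.5: the function `f` defined by the semigroup formula is well defined,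
differentiable, and solves Stein's equation
`L^{α,δ} f(x) − (1/α) x f'(x) = h(x) − E[h(Z)]`. -/
theorem stein_equation_solution
    (α δ β : ℝ) (hα0 : 0 < α) (hα1 : α ≤ 1) (hδ : δ ∈ Set.Ioo (-1 : ℝ) 1)
    (h1 : α = 1 → δ = 0) (hβ0 : 0 < β) (hβα : β < α)
    (μZ : Measure ℝ) [IsProbabilityMeasure μZ] (hZ : IsStableLaw α δ μZ)
    (p : ℝ → ℝ) (hp0 : ∀ x, 0 ≤ p x) (hpc : Continuous p)
    (hpd : μZ = volume.withDensity fun x => ENNReal.ofReal (p x))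
    (h : ℝ → ℝ) (hh : memHbeta β h)
    (f : ℝ → ℝ) (hf : f = steinSol α p h) :
    (∀ x t : ℝ, 0 < t → Integrable (fun y =>
        p y * (h ((1 - Real.exp (-t)) ^ (1/α) * y + Real.exp (-t/α) * x) - h y))) ∧
    (∀ x : ℝ, IntegrableOn (fun t => ∫ y, p y *
        (h ((1 - Real.exp (-t)) ^ (1/α) * y + Real.exp (-t/α) * x) - h y)) (Set.Ioi 0)) ∧
    Differentiable ℝ f ∧
    (∀ x : ℝ, LopA α δ f x - (1/α) * x * deriv f x = h x - ∫ y, h y ∂μZ) := by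
  have hZ' : ∀ l : ℝ, ∫ x : ℝ, Complex.exp (((l * x : ℝ) : ℂ) * Complex.I) ∂μZ = Complex.exp (-psi α δ l) := by
    intro l
    rw [← stableCF_one, ← hZ l]
    congr 1; funext x; congr 1; push_cast; ring
  have hpsi : ∀ l : ℝ, ‖psi α δ l‖ ≤ (‖psi α δ 1‖ + ‖psi α δ (-1)‖) * |l| ^ α := by
    intro l
    have hr : 0 ≤ |l| ^ α := by positivity
    have hn : ‖((|l| ^ α : ℝ) : ℂ)‖ = |l| ^ α := by
      rw [Complex.norm_real, Real.norm_eq_abs, abs_of_nonneg hr]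
    rcases le_total 0 l with hl | hl
    · have e := psi_smul hα0 δ (abs_nonneg l) 1
      rw [show |l| * 1 = l by rw [abs_of_nonneg hl, mul_one]] at e
      rw [e, norm_mul, hn]
      nlinarith [norm_nonneg (psi α δ 1), norm_nonneg (psi α δ (-1))]
    · have e := psi_smul hα0 δ (abs_nonneg l) (-1)
      rw [show |l| * (-1) = l by rw [abs_of_nonpos hl]; ring] at e
      rw [e, norm_mul, hn]
      nlinarith [norm_nonneg (psi α δ 1), norm_nonneg (psi α δ (-1))]
  have S : Setup α β μZ := by
    refine ⟨hα0, hα1, hβ0, hβα, ?_, ?_⟩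
    · refine moment_of_charFun μZ hβ0 hβα (C := ‖psi α δ 1‖ + ‖psi α δ (-1)‖) fun l => ?_
      rw [charFun_apply_real]
      have := hZ' l
      push_cast at this
      rw [this, norm_sub_rev]
      exact (norm_exp_neg_sub_one_le (psi_re_nonneg _ _ _)).trans (hpsi l)
    · rw [hpd]; exact withDensity_absolutelyContinuous _ _
  have H : memC β 1 h := fun x y => by rw [one_mul]; exact hh x y
  have hpm : Measurable (fun x => ENNReal.ofReal (p x)) := hpc.measurable.ennreal_ofReal
  have key : ∀ g : ℝ → ℝ, ∫ y, g y ∂μZ = ∫ y, p y * g y := by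
    intro g
    rw [hpd, integral_withDensity_eq_integral_toReal_smul hpm (by simp)]
    congr 1; funext y
    rw [ENNReal.toReal_ofReal (hp0 y), smul_eq_mul]
  have keyi : ∀ g : ℝ → ℝ, Integrable g μZ → Integrable (fun y => p y * g y) := by
    intro g hg
    rw [hpd, integrable_withDensity_iff_integrable_smul' hpm (by simp)] at hg
    refine hg.congr (ae_of_all _ fun y => ?_)
    simp only [ENNReal.toReal_ofReal (hp0 y), smul_eq_mul]
  have hGG : ∀ x t : ℝ, GG α μZ h t x = ∫ y, p y *
        (h ((1 - Real.exp (-t)) ^ (1/α) * y + Real.exp (-t/α) * x) - h y) := fun x t => key _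
  have hfF : f = FF α μZ h := by
    rw [hf]; funext x
    unfold steinSol FF
    simp_rw [hGG]
  refine ⟨fun x t ht => keyi _ (S.G1 H ht.le x), fun x => ?_, ?_, ?_⟩
  · simp_rw [← hGG]; exact S.Gint H x
  · rw [hfF]; exact fun x => (S.F6 H x).differentiableAt
  · intro x
    rw [hfF]
    rcases eq_or_lt_of_le hα1 with e1 | hlt
    · have hδ0 := h1 e1
      subst e1
      subst hδ0
      have hμ : μZ = volume.withDensity (fun y => ENNReal.ofReal (qq y)) := by
        apply cauchy_unique
        intro l
        rw [hZ' l]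
        simp [psi]
      have B := KB_one S hμ
      have P := INTG.toPW S B H (INTG_all S (levyData_one 0) B hZ' H) x
      rw [← Lop1_eq S hμ H] at P
      unfold LopA
      rw [if_pos rfl]
      exact P
    · have B := KB_lt (δ := δ) S hlt
      have P := INTG.toPW S B H (INTG_all S (levyData_lt hα0 hlt) B hZ' H) x
      unfold LopA
      rw [if_neg hlt.ne]
      rw [← P]
      congr 1
      unfold Lop LL DD
      simp
end
end

section
/- Let α = 1, δ = 0, h ∈ H_β with 0 < β < 1, and let f be the Stein solution f(x) = −∫_0^∞ ∫_ℝ p(y)[h((1 − e^{−t}) y + e^{−t} x) − h(y)] dy dt, where p is the density of the standard Cauchy law S_1(0). Then f is differentiable with ‖f'‖_∞ ≤ 1, and there is a constant C > 0 such that |f'(x) − f'(z)| ≤ C (2 − log|x − z|) |x − z| whenever 0 < |x − z| < 1. -/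
open MeasureTheory Real Filter Set
open scoped Topology

noncomputable section

/-- The standard Cauchy density. -/
def cauchyDens (y : ℝ) : ℝ := 1 / (π * (1 + y ^ 2))

lemma abs_int_le {α : Type*} [MeasurableSpace α] {μ : Measure α} {f g : α → ℝ} (hg : Integrable g μ)
    (h : ∀ᵐ x ∂μ, ‖f x‖ ≤ g x) : |∫ x, f x ∂μ| ≤ ∫ x, g x ∂μ :=
  norm_integral_le_of_norm_le hg h

lemma cd_nonneg (y : ℝ) : 0 ≤ cauchyDens y := by unfold cauchyDens; positivity

lemma cd_eq (y : ℝ) : cauchyDens y = π⁻¹ * (1 + y ^ 2)⁻¹ := by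
  unfold cauchyDens; rw [one_div, mul_inv]

lemma cd_cont : Continuous cauchyDens := by
  unfold cauchyDens
  refine continuous_const.div (by fun_prop) fun y => ?_
  have := Real.pi_pos
  positivity

lemma cd_integrable : Integrable cauchyDens := by
  rw [funext cd_eq]; exact integrable_inv_one_add_sq.const_mul _

lemma cd_integral : ∫ y, cauchyDens y = 1 := by
  simp_rw [cd_eq]
  rw [integral_const_mul, integral_univ_inv_one_add_sq, inv_mul_cancel₀ Real.pi_ne_zero]

lemma cd_diff (y a : ℝ) : |cauchyDens (y - a) - cauchyDens y| ≤
    |a| / 2 * (cauchyDens (y - a) + cauchyDens y) := by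
  simp only [cd_eq]
  set w := y - a with hw
  have ha : a = y - w := by rw [hw]; ring
  have hpi := Real.pi_pos
  have h1 : π⁻¹ * (1 + w ^ 2)⁻¹ - π⁻¹ * (1 + y ^ 2)⁻¹ =
      π⁻¹ * ((1 + w ^ 2)⁻¹ * (1 + y ^ 2)⁻¹) * (a * (y + w)) := by
    rw [ha]; field_simp; ring
  have h2 : |a| / 2 * (π⁻¹ * (1 + w ^ 2)⁻¹ + π⁻¹ * (1 + y ^ 2)⁻¹) =
      π⁻¹ * ((1 + w ^ 2)⁻¹ * (1 + y ^ 2)⁻¹) * (|a| * ((2 + y ^ 2 + w ^ 2) / 2)) := by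
    field_simp; ring
  rw [h1, h2, abs_mul, abs_of_nonneg (by positivity : 0 ≤ π⁻¹ * ((1 + w ^ 2)⁻¹ * (1 + y ^ 2)⁻¹)),
    abs_mul a]
  gcongr
  rw [abs_le]; constructor <;> nlinarith [sq_nonneg (y+1), sq_nonneg (w+1), sq_nonneg (y-1), sq_nonneg (w-1)]

lemma cd_moment (β : ℝ) (hβ0 : 0 < β) (hβ1 : β < 1) (x : ℝ) :
    Integrable fun y => cauchyDens y * |x - y| ^ β := by
  have hI : Integrable (fun y : ℝ => ((1 : ℝ) + ‖y‖ ^ 2) ^ (-(2 - β) / 2)) :=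
    integrable_rpow_neg_one_add_norm_sq (by simp; linarith)
  refine (hI.const_mul (π⁻¹ * (|x| + 1) ^ β)).mono' ?_ ?_
  · exact (cd_cont.mul (Continuous.rpow_const (by fun_prop) fun y => Or.inr hβ0.le)).aestronglyMeasurable
  · refine Eventually.of_forall fun y => ?_
    have hpi := Real.pi_pos
    rw [Real.norm_of_nonneg (mul_nonneg (cd_nonneg y) (by positivity)), cd_eq, Real.norm_eq_abs, sq_abs]
    have hw : (0:ℝ) < 1 + y ^ 2 := by positivity
    have e1 : (1 + y ^ 2) ^ (-(2 - β) / 2) = (1 + y ^ 2)⁻¹ * (√(1 + y ^ 2)) ^ β := by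
      rw [Real.sqrt_eq_rpow, ← Real.rpow_mul hw.le, ← Real.rpow_neg_one, ← Real.rpow_add hw]
      congr 1; ring
    have hs1 : 1 ≤ √(1 + y ^ 2) := by rw [Real.one_le_sqrt]; nlinarith [sq_nonneg y]
    have hs2 : |y| ≤ √(1 + y ^ 2) := Real.abs_le_sqrt (by linarith)
    have e2 : |x - y| ≤ (|x| + 1) * √(1 + y ^ 2) := by
      have := abs_sub x y
      nlinarith [abs_nonneg x]
    have e3 : |x - y| ^ β ≤ (|x| + 1) ^ β * √(1 + y ^ 2) ^ β := by
      rw [← Real.mul_rpow (by positivity) (by positivity)]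
      exact Real.rpow_le_rpow (abs_nonneg _) e2 hβ0.le
    rw [e1]
    calc π⁻¹ * (1 + y ^ 2)⁻¹ * |x - y| ^ β ≤ π⁻¹ * (1 + y ^ 2)⁻¹ * ((|x| + 1) ^ β * √(1 + y ^ 2) ^ β) := by gcongr
      _ = _ := by ring

/-- averaged function -/
def avg (k : ℝ → ℝ) (t x : ℝ) : ℝ :=
  ∫ y, cauchyDens y * k ((1 - Real.exp (-t)) * y + Real.exp (-t) * x)

lemma avg_integrable (k : ℝ → ℝ) (hk : Measurable k) (hk1 : ∀ u, |k u| ≤ 1) (s c : ℝ) :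
    Integrable fun y => cauchyDens y * k (s * y + c) := by
  refine cd_integrable.mono' ?_ ?_
  · exact (cd_cont.measurable.mul (hk.comp (by fun_prop))).aestronglyMeasurable
  · refine Eventually.of_forall fun y => ?_
    rw [norm_mul, Real.norm_of_nonneg (cd_nonneg y)]
    exact mul_le_of_le_one_right (cd_nonneg y) (hk1 _)

lemma avg_le (k : ℝ → ℝ) (hk1 : ∀ u, |k u| ≤ 1) (t x : ℝ) : |avg k t x| ≤ 1 := by
  rw [← cd_integral]
  refine abs_int_le cd_integrable (Eventually.of_forall fun y => ?_)
  rw [norm_mul, Real.norm_of_nonneg (cd_nonneg y)]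
  exact mul_le_of_le_one_right (cd_nonneg y) (hk1 _)

lemma avg_meas (k : ℝ → ℝ) (hk : Measurable k) (x : ℝ) :
    StronglyMeasurable fun t => avg k t x := by
  unfold avg
  refine StronglyMeasurable.integral_prod_right (f := fun t y => cauchyDens y * k ((1 - Real.exp (-t)) * y + Real.exp (-t) * x)) ?_
  refine Measurable.stronglyMeasurable ?_
  exact (cd_cont.measurable.comp measurable_snd).mul (hk.comp (by fun_prop))

lemma avg_diff (k : ℝ → ℝ) (hk : Measurable k) (hk1 : ∀ u, |k u| ≤ 1) (t x z : ℝ) (ht : 0 < t) :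
    |avg k t x - avg k t z| ≤ |x - z| / t := by
  have hs : 0 < 1 - Real.exp (-t) := by
    have : Real.exp (-t) < 1 := by rw [Real.exp_lt_one_iff]; linarith
    linarith
  set s := 1 - Real.exp (-t) with hsd
  set e := Real.exp (-t) with he
  have hepos : 0 < e := Real.exp_pos _
  set a := e * (x - z) / s with had
  have h1 : avg k t x = ∫ y, cauchyDens (y - a) * k (s * y + e * z) := by
    rw [← integral_add_right_eq_self _ a]
    unfold avg
    refine integral_congr_ae (Eventually.of_forall fun y => ?_)
    simp only [add_sub_cancel_right]
    congr 2
    rw [had]; field_simp; ring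
  have hi1 : Integrable fun y => cauchyDens (y - a) * k (s * y + e * z) := by
    have := (avg_integrable k hk hk1 s (s * a + e * z)).comp_sub_right a
    refine this.congr (Eventually.of_forall fun y => ?_)
    simp only
    congr 2; ring
  have hi2 := avg_integrable k hk hk1 s (e * z)
  have h2 : avg k t x - avg k t z = ∫ y, (cauchyDens (y - a) - cauchyDens y) * k (s * y + e * z) := by
    rw [h1, avg, ← integral_sub hi1 hi2]
    refine integral_congr_ae (Eventually.of_forall fun y => ?_)
    simp only; ring
  have hc : Integrable fun y => cauchyDens (y - a) := cd_integrable.comp_sub_right a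
  have h3 : |avg k t x - avg k t z| ≤ |a| := by
    have : ∫ y, |a| / 2 * (cauchyDens (y - a) + cauchyDens y) = |a| := by
      rw [integral_const_mul, integral_add hc cd_integrable, integral_sub_right_eq_self cauchyDens a,
        cd_integral]
      ring
    rw [h2, ← this]
    refine abs_int_le ((hc.add cd_integrable).const_mul _) (Eventually.of_forall fun y => ?_)
    rw [norm_mul]
    refine (mul_le_of_le_one_right (norm_nonneg _) (hk1 _)).trans (cd_diff y a)
  refine h3.trans ?_
  rw [had, abs_div, abs_mul, abs_of_pos hs, abs_of_pos hepos, div_le_div_iff₀ hs ht]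
  have : e * t ≤ s := by
    have h5 : t + 1 ≤ Real.exp t := Real.add_one_le_exp t
    have h6 : e * Real.exp t = 1 := by rw [he, ← Real.exp_add]; simp
    nlinarith
  nlinarith [abs_nonneg (x - z)]

lemma H_lip {β : ℝ} {h : ℝ → ℝ} (hh : memHbeta β h) : LipschitzWith 1 h :=
  LipschitzWith.of_dist_le_mul fun x y => by
    simpa [Real.dist_eq] using (hh x y).trans (min_le_left _ _)

lemma ae_diff {h : ℝ → ℝ} (hl : LipschitzWith 1 h) {s : ℝ} (hs : s ≠ 0) (c : ℝ) :
    ∀ᵐ y : ℝ, DifferentiableAt ℝ h (s * y + c) := by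
  have h0 := hl.ae_differentiableAt_real
  rw [ae_iff] at h0 ⊢
  have : {y : ℝ | ¬ DifferentiableAt ℝ h (s * y + c)} =
    (s * ·) ⁻¹' ((· + c) ⁻¹' {u | ¬ DifferentiableAt ℝ h u}) := rfl
  rw [this, Real.volume_preimage_mul_left hs, measure_preimage_add_right, h0, mul_zero]

/-- inner integral -/
def inn (h : ℝ → ℝ) (t x : ℝ) : ℝ :=
  ∫ y, cauchyDens y * (h ((1 - Real.exp (-t)) * y + Real.exp (-t) * x) - h y)

lemma inn_pt {β : ℝ} (hβ0 : 0 < β) {h : ℝ → ℝ} (hh : memHbeta β h) (t x y : ℝ) :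
    ‖cauchyDens y * (h ((1 - Real.exp (-t)) * y + Real.exp (-t) * x) - h y)‖ ≤
      Real.exp (-β * t) * (cauchyDens y * |x - y| ^ β) := by
  have h1 := (hh ((1 - Real.exp (-t)) * y + Real.exp (-t) * x) y).trans (min_le_right _ _)
  have h2 : (1 - Real.exp (-t)) * y + Real.exp (-t) * x - y = Real.exp (-t) * (x - y) := by ring
  rw [h2, abs_mul, abs_of_pos (Real.exp_pos _), Real.mul_rpow (Real.exp_pos _).le (abs_nonneg _),
    ← Real.exp_mul] at h1
  rw [norm_mul, Real.norm_of_nonneg (cd_nonneg y), Real.norm_eq_abs]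
  calc _ ≤ cauchyDens y * (Real.exp (-t * β) * |x - y| ^ β) :=
        mul_le_mul_of_nonneg_left h1 (cd_nonneg y)
    _ = _ := by rw [show -t * β = -β * t by ring]; ring

lemma inn_integrable {β : ℝ} (hβ0 : 0 < β) (hβ1 : β < 1) {h : ℝ → ℝ} (hh : memHbeta β h) (t x : ℝ) :
    Integrable fun y => cauchyDens y * (h ((1 - Real.exp (-t)) * y + Real.exp (-t) * x) - h y) := by
  refine ((cd_moment β hβ0 hβ1 x).const_mul (Real.exp (-β * t))).mono' ?_
    (Eventually.of_forall fun y => inn_pt hβ0 hh t x y)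
  have := (H_lip hh).continuous
  have := cd_cont
  exact Continuous.aestronglyMeasurable (by fun_prop)

lemma inn_meas {β : ℝ} {h : ℝ → ℝ} (hh : memHbeta β h) (x : ℝ) :
    StronglyMeasurable fun t => inn h t x := by
  unfold inn
  refine StronglyMeasurable.integral_prod_right (f := fun t y => cauchyDens y * (h ((1 - Real.exp (-t)) * y + Real.exp (-t) * x) - h y)) ?_
  have := (H_lip hh).continuous
  have := cd_cont
  refine Continuous.stronglyMeasurable ?_
  unfold Function.uncurry
  fun_prop

lemma inn_outer {β : ℝ} (hβ0 : 0 < β) (hβ1 : β < 1) {h : ℝ → ℝ} (hh : memHbeta β h) (x : ℝ) :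
    IntegrableOn (fun t => inn h t x) (Ioi 0) := by
  refine ((exp_neg_integrableOn_Ioi 0 hβ0).mul_const (∫ y, cauchyDens y * |x - y| ^ β)).mono'
    (inn_meas hh x).aestronglyMeasurable (Eventually.of_forall fun t => ?_)
  rw [← integral_const_mul]
  exact norm_integral_le_of_norm_le ((cd_moment β hβ0 hβ1 x).const_mul _)
    (Eventually.of_forall fun y => inn_pt hβ0 hh t x y)

lemma inn_deriv {β : ℝ} (hβ0 : 0 < β) (hβ1 : β < 1) {h : ℝ → ℝ} (hh : memHbeta β h) (t x : ℝ)
    (ht : 0 < t) : HasDerivAt (fun x => inn h t x) (Real.exp (-t) * avg (deriv h) t x) x := by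
  have hs : 1 - Real.exp (-t) ≠ 0 := by
    have : Real.exp (-t) < 1 := by rw [Real.exp_lt_one_iff]; linarith
    linarith
  have hl := H_lip hh
  have key := hasDerivAt_integral_of_dominated_loc_of_lip (𝕜 := ℝ) (μ := volume) (x₀ := x) (s := univ)
    (F := fun x y => cauchyDens y * (h ((1 - Real.exp (-t)) * y + Real.exp (-t) * x) - h y))
    (F' := fun y => cauchyDens y * (deriv h ((1 - Real.exp (-t)) * y + Real.exp (-t) * x) * Real.exp (-t)))
    (bound := fun y => cauchyDens y * Real.exp (-t)) univ_mem
    (Eventually.of_forall fun x => (inn_integrable hβ0 hβ1 hh t x).aestronglyMeasurable)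
    (inn_integrable hβ0 hβ1 hh t x)
    (cd_cont.measurable.mul (((measurable_deriv h).comp (by fun_prop)).mul_const _)).aestronglyMeasurable
    (Eventually.of_forall fun y => ?_) (cd_integrable.mul_const _) ?_
  · have e : Real.exp (-t) * avg (deriv h) t x = ∫ y, cauchyDens y *
        (deriv h ((1 - Real.exp (-t)) * y + Real.exp (-t) * x) * Real.exp (-t)) := by
      rw [avg, ← integral_const_mul]
      refine integral_congr_ae (Eventually.of_forall fun y => ?_)
      simp only; ring
    rw [e]
    exact key.2
  · refine LipschitzWith.lipschitzOnWith (LipschitzWith.of_dist_le_mul fun a b => ?_)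
    have hb : 0 ≤ cauchyDens y * Real.exp (-t) := mul_nonneg (cd_nonneg y) (Real.exp_pos _).le
    rw [Real.coe_nnabs, abs_of_nonneg hb, Real.dist_eq, Real.dist_eq, ← mul_sub, abs_mul,
      abs_of_nonneg (cd_nonneg y), mul_assoc]
    refine mul_le_mul_of_nonneg_left ?_ (cd_nonneg y)
    have h1 := (hh ((1 - Real.exp (-t)) * y + Real.exp (-t) * a) ((1 - Real.exp (-t)) * y + Real.exp (-t) * b)).trans (min_le_left _ _)
    rw [add_sub_add_left_eq_sub, ← mul_sub, abs_mul, abs_of_pos (Real.exp_pos _)] at h1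
    rwa [sub_sub_sub_cancel_right]
  · filter_upwards [ae_diff hl hs (Real.exp (-t) * x)] with y hy
    have h1 : HasDerivAt (fun x => (1 - Real.exp (-t)) * y + Real.exp (-t) * x) (Real.exp (-t)) x := by
      simpa using ((hasDerivAt_id x).const_mul (Real.exp (-t))).const_add ((1 - Real.exp (-t)) * y)
    exact ((hy.hasDerivAt.comp x h1).sub_const _).const_mul _

lemma inn_lip {β : ℝ} (hβ0 : 0 < β) (hβ1 : β < 1) {h : ℝ → ℝ} (hh : memHbeta β h) (t a b : ℝ) :
    |inn h t a - inn h t b| ≤ Real.exp (-t) * |a - b| := by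
  unfold inn
  rw [← integral_sub (inn_integrable hβ0 hβ1 hh t a) (inn_integrable hβ0 hβ1 hh t b)]
  have : ∫ y, cauchyDens y * (Real.exp (-t) * |a - b|) = Real.exp (-t) * |a - b| := by
    rw [integral_mul_const, cd_integral, one_mul]
  rw [← this]
  refine abs_int_le (cd_integrable.mul_const _) (Eventually.of_forall fun y => ?_)
  rw [Real.norm_eq_abs, ← mul_sub, abs_mul, abs_of_nonneg (cd_nonneg y)]
  refine mul_le_mul_of_nonneg_left ?_ (cd_nonneg y)
  have h1 := (hh ((1 - Real.exp (-t)) * y + Real.exp (-t) * a) ((1 - Real.exp (-t)) * y + Real.exp (-t) * b)).trans (min_le_left _ _)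
  rw [add_sub_add_left_eq_sub, ← mul_sub, abs_mul, abs_of_pos (Real.exp_pos _)] at h1
  rwa [sub_sub_sub_cancel_right]

lemma exp_int : IntegrableOn (fun t : ℝ => Real.exp (-t)) (Ioi 0) := by
  simpa using exp_neg_integrableOn_Ioi 0 one_pos

lemma stein_deriv {β : ℝ} (hβ0 : 0 < β) (hβ1 : β < 1) {h : ℝ → ℝ} (hh : memHbeta β h) (x : ℝ) :
    HasDerivAt (steinSol 1 cauchyDens h)
      (-∫ t in Ioi (0:ℝ), Real.exp (-t) * avg (deriv h) t x) x := by
  have e : steinSol 1 cauchyDens h = fun x => -∫ t in Ioi (0:ℝ), inn h t x := by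
    funext x
    simp only [steinSol, inn, div_one, Real.rpow_one]
  rw [e]
  refine HasDerivAt.neg ?_
  refine (hasDerivAt_integral_of_dominated_loc_of_lip (𝕜 := ℝ) (μ := volume.restrict (Ioi (0:ℝ))) (x₀ := x)
    (s := univ) (F := fun x t => inn h t x) (bound := fun t => Real.exp (-t)) univ_mem
    (Eventually.of_forall fun x => (inn_meas hh x).aestronglyMeasurable)
    (inn_outer hβ0 hβ1 hh x) ?_ (Eventually.of_forall fun t => ?_) exp_int ?_).2
  · exact ((by fun_prop : Continuous fun t : ℝ => Real.exp (-t)).stronglyMeasurable.mul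
      (avg_meas _ (measurable_deriv h) x)).aestronglyMeasurable
  · refine LipschitzWith.lipschitzOnWith (LipschitzWith.of_dist_le_mul fun a b => ?_)
    rw [Real.coe_nnabs, abs_of_pos (Real.exp_pos _), Real.dist_eq, Real.dist_eq]
    exact inn_lip hβ0 hβ1 hh t a b
  · filter_upwards [ae_restrict_mem measurableSet_Ioi] with t ht
    exact inn_deriv hβ0 hβ1 hh t x ht

lemma outer_bound (g : ℝ → ℝ) (hg : AEStronglyMeasurable g (volume.restrict (Ioi (0:ℝ)))) (d : ℝ)
    (hd0 : 0 < d) (hd1 : d < 1)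
    (h2 : ∀ t, |g t| ≤ 2) (hd : ∀ t, 0 < t → |g t| ≤ d / t) :
    |∫ t in Ioi (0:ℝ), Real.exp (-t) * g t| ≤ 2 * ((2 - Real.log d) * d) := by
  have hexp1 : ∀ t : ℝ, 0 < t → Real.exp (-t) ≤ 1 := fun t ht => by
    rw [Real.exp_le_one_iff]; linarith
  have hi : IntegrableOn (fun t => Real.exp (-t) * g t) (Ioi 0) := by
    refine (exp_int.mul_const 2).mono' (((by fun_prop : Continuous fun t : ℝ => Real.exp (-t)).aestronglyMeasurable).mul hg)
      (Eventually.of_forall fun t => ?_)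
    rw [norm_mul, Real.norm_of_nonneg (Real.exp_pos _).le]
    exact mul_le_mul_of_nonneg_left (h2 t) (Real.exp_pos _).le
  have hi1 : IntegrableOn (fun t => Real.exp (-t) * g t) (Ioi d) := hi.mono_set (Ioi_subset_Ioi hd0.le)
  have s1 := setIntegral_union (f := fun t => Real.exp (-t) * g t) (Ioc_disjoint_Ioi (le_refl d)) measurableSet_Ioi
    (hi.mono_set (Ioc_subset_Ioi_self : Ioc 0 d ⊆ Ioi 0)) hi1
  rw [Ioc_union_Ioi_eq_Ioi hd0.le] at s1
  have s2 := setIntegral_union (f := fun t => Real.exp (-t) * g t) (Ioc_disjoint_Ioi (le_refl (1:ℝ))) measurableSet_Ioi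
    (hi1.mono_set (Ioc_subset_Ioi_self : Ioc d 1 ⊆ Ioi d)) (hi.mono_set (Ioi_subset_Ioi zero_le_one))
  rw [Ioc_union_Ioi_eq_Ioi hd1.le] at s2
  have b1 : |∫ t in Ioc 0 d, Real.exp (-t) * g t| ≤ 2 * d := by
    have := norm_setIntegral_le_of_norm_le_const (μ := volume) (s := Ioc 0 d) (C := 2)
      (f := fun t => Real.exp (-t) * g t) (by simp) (fun t ht => by
        rw [norm_mul, Real.norm_of_nonneg (Real.exp_pos _).le]
        have := h2 t
        have := hexp1 t ht.1
        rw [Real.norm_eq_abs]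
        nlinarith [abs_nonneg (g t), Real.exp_pos (-t)])
    simpa [hd0.le] using this
  have b2 : |∫ t in Ioc d 1, Real.exp (-t) * g t| ≤ d * (-Real.log d) := by
    have e : ∫ t in Ioc d 1, d * (1 / t) = d * (-Real.log d) := by
      rw [← intervalIntegral.integral_of_le hd1.le, intervalIntegral.integral_const_mul,
        integral_one_div_of_pos hd0 one_pos, one_div, Real.log_inv]
    rw [← e]
    refine abs_int_le ?_ ?_
    · have : IntervalIntegrable (fun t : ℝ => d * (1 / t)) volume d 1 := by
        refine ContinuousOn.intervalIntegrable ?_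
        rw [uIcc_of_le hd1.le]
        refine continuousOn_const.mul (continuousOn_const.div continuousOn_id fun t ht => ?_)
        exact (hd0.trans_le ht.1).ne'
      exact (intervalIntegrable_iff_integrableOn_Ioc_of_le hd1.le).1 this
    · filter_upwards [ae_restrict_mem measurableSet_Ioc] with t ht
      have ht0 : 0 < t := hd0.trans ht.1
      rw [norm_mul, Real.norm_of_nonneg (Real.exp_pos _).le, Real.norm_eq_abs, mul_one_div]
      exact (mul_le_of_le_one_left (abs_nonneg _) (hexp1 t ht0)).trans (hd t ht0)
  have b3 : |∫ t in Ioi 1, Real.exp (-t) * g t| ≤ d := by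
    have e : ∫ t in Ioi (1:ℝ), Real.exp (-t) * d ≤ d := by
      rw [integral_mul_const, integral_exp_neg_Ioi]
      exact mul_le_of_le_one_left hd0.le (hexp1 1 one_pos)
    refine le_trans ?_ e
    refine abs_int_le ((exp_int.mono_set (Ioi_subset_Ioi zero_le_one)).mul_const d) ?_
    filter_upwards [ae_restrict_mem measurableSet_Ioi] with t ht
    have ht1 : 1 < t := ht
    rw [norm_mul, Real.norm_of_nonneg (Real.exp_pos _).le, Real.norm_eq_abs]
    refine mul_le_mul_of_nonneg_left ((hd t (by linarith)).trans (div_le_self hd0.le ht1.le)) (Real.exp_pos _).le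
  rw [s1, s2]
  have hlog : Real.log d ≤ 0 := Real.log_nonpos hd0.le hd1.le
  have t1 := abs_add_le (∫ t in Ioc 0 d, Real.exp (-t) * g t)
    ((∫ t in Ioc d 1, Real.exp (-t) * g t) + ∫ t in Ioi 1, Real.exp (-t) * g t)
  have t2 := abs_add_le (∫ t in Ioc d 1, Real.exp (-t) * g t) (∫ t in Ioi 1, Real.exp (-t) * g t)
  nlinarith [mul_nonneg hd0.le (neg_nonneg.2 hlog)]

/-- Proposition 3.2 (i): for the Cauchy Stein solution, `‖f'‖_∞ ≤ 1` and `f'` has a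
log-Lipschitz modulus of continuity. -/
theorem stein_solution_deriv_bounds_cauchy
    (β : ℝ) (hβ0 : 0 < β) (hβ1 : β < 1)
    (h : ℝ → ℝ) (hh : memHbeta β h)
    (f : ℝ → ℝ) (hf : f = steinSol 1 cauchyDens h) :
    Differentiable ℝ f ∧ (∀ x, |deriv f x| ≤ 1) ∧
    ∃ C > 0, ∀ x z : ℝ, 0 < |x - z| → |x - z| < 1 →
      |deriv f x - deriv f z| ≤ C * ((2 - Real.log |x - z|) * |x - z|) := by
  subst hf
  have hk : Measurable (deriv h) := measurable_deriv h
  have hk1 : ∀ u, |deriv h u| ≤ 1 := fun u => by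
    simpa using norm_deriv_le_of_lipschitz (H_lip hh) (x₀ := u)
  have hD := stein_deriv hβ0 hβ1 hh
  have hint : ∀ x, IntegrableOn (fun t => Real.exp (-t) * avg (deriv h) t x) (Ioi 0) := fun x => by
    refine exp_int.mono' ((by fun_prop : Continuous fun t : ℝ => Real.exp (-t)).aestronglyMeasurable.mul
      (avg_meas _ hk x).aestronglyMeasurable) (Eventually.of_forall fun t => ?_)
    rw [norm_mul, Real.norm_of_nonneg (Real.exp_pos _).le]
    exact mul_le_of_le_one_right (Real.exp_pos _).le (avg_le _ hk1 t x)
  refine ⟨fun x => (hD x).differentiableAt, fun x => ?_, 2, two_pos, fun x z h0 h1 => ?_⟩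
  · rw [(hD x).deriv, abs_neg, ← integral_exp_neg_Ioi_zero]
    refine abs_int_le exp_int (Eventually.of_forall fun t => ?_)
    rw [norm_mul, Real.norm_of_nonneg (Real.exp_pos _).le]
    exact mul_le_of_le_one_right (Real.exp_pos _).le (avg_le _ hk1 t x)
  · rw [(hD x).deriv, (hD z).deriv, neg_sub_neg, abs_sub_comm, ← integral_sub (hint x) (hint z)]
    simp_rw [← mul_sub]
    refine outer_bound (fun t => avg (deriv h) t x - avg (deriv h) t z)
      ((avg_meas _ hk x).sub (avg_meas _ hk z)).aestronglyMeasurable _ h0 h1 (fun t => ?_)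
      (fun t ht => avg_diff _ hk hk1 t x z ht)
    have := abs_sub (avg (deriv h) t x) (avg (deriv h) t z)
    linarith [avg_le _ hk1 t x, avg_le _ hk1 t z]
end
end
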